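/- arXiv:1108.6272 — 2 statements merged into one kernel-verified Lean document; each statement's English description precedes it below -/
import Mathlib

section
/- For every ε > 0 there exists a constant C(ε) > 0 with the following property. Let σ > 0, let D be a positive integer, and let X ≥ 1 be a real number satisfying D^{σ/2} < X^{4 − σ − 16ε}. Then for every odd prime p with p < (√D·X)^σ, |∑_{f ∈ F(X)} (f/p)| ≤ C(ε)·τ(D)·X^{1−ε²}, where (f/p) denotes the Legendre symbol of f modulo p and τ(D) the number of positive divisors of D. -/
/-- An integer `f` is a fundamental discriminant if either `f ≡ 1 (mod 4)` and `f` is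
squarefree, or `f = 4m` with `m` squarefree and `m ≡ 2` or `3 (mod 4)`. -/
def IsFundamentalDiscriminant (f : ℤ) : Prop :=
  (f % 4 = 1 ∧ Squarefree f) ∨
  (∃ m : ℤ, f = 4 * m ∧ Squarefree m ∧ (m % 4 = 2 ∨ m % 4 = 3))

/-- `F(X)`: the set of fundamental discriminants `f` with `gcd(f, D) = 1` and
`X ≤ |f| < 2X`. -/
def FSet (D : ℕ) (X : ℝ) : Set ℤ :=
  {f | IsFundamentalDiscriminant f ∧ IsCoprime f (D : ℤ) ∧
    X ≤ |(f : ℝ)| ∧ |(f : ℝ)| < 2 * X}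

section

open Polynomial

/-- The operator `r ↦ t` determined by `(f ^ e * r)^{(k)} = f ^ (e - k) * t`. -/
noncomputable def powDerivCofactor {K : Type*} [Field K] (f : K[X]) (e : ℕ) : ℕ → K[X] →ₗ[K] K[X]
  | 0 => LinearMap.id
  | k + 1 => LinearMap.mulLeft K f ∘ₗ derivative ∘ₗ powDerivCofactor f e k
      + LinearMap.mulLeft K (((e - k : ℕ) : K[X]) * derivative f) ∘ₗ powDerivCofactor f e k

lemma iterate_derivative_pow_mul_eq {K : Type*} [Field K] (f : K[X]) (e : ℕ) (r : K[X]) (k : ℕ)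
    (hk : k ≤ e) :
    derivative^[k] (f ^ e * r) = f ^ (e - k) * powDerivCofactor f e k r := by
  induction k with
  | zero => simp [powDerivCofactor]
  | succ k ih =>
    rw [Function.iterate_succ_apply', ih (by omega)]
    obtain ⟨n, hn⟩ : ∃ n, e - k = n + 1 := ⟨e - k - 1, by omega⟩
    have hn' : e - (k + 1) = n := by omega
    simp only [powDerivCofactor, hn, hn', LinearMap.add_apply, LinearMap.comp_apply,
      LinearMap.mulLeft_apply, derivative_mul, derivative_pow, Nat.add_sub_cancel]
    push_cast
    simp
    ring

lemma natDegree_powDerivCofactor_le {K : Type*} [Field K] {f : K[X]} {m : ℕ}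
    (hf : f.natDegree ≤ m) (e : ℕ) {r : K[X]} {n : ℕ} (hr : r.natDegree ≤ n) (k : ℕ) :
    (powDerivCofactor f e k r).natDegree ≤ n + k * m := by
  induction k with
  | zero => simpa [powDerivCofactor] using hr
  | succ k ih =>
    simp only [powDerivCofactor, LinearMap.add_apply, LinearMap.comp_apply,
      LinearMap.mulLeft_apply]
    refine natDegree_add_le_of_degree_le ?_ ?_
    · refine natDegree_mul_le.trans ?_
      have := natDegree_derivative_le (powDerivCofactor f e k r)
      rw [add_mul, one_mul]
      omega
    · refine natDegree_mul_le.trans ?_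
      have h1 : (((e - k : ℕ) : K[X]) * derivative f).natDegree ≤ m := by
        refine natDegree_mul_le.trans ?_
        have := natDegree_derivative_le f
        rw [natDegree_natCast]
        omega
      rw [add_mul, one_mul]
      omega

lemma iterate_derivative_X_pow_mul_of_charP {K : Type*} [Field K] (p : ℕ) [CharP K p] (j : ℕ)
    (q : K[X]) (k : ℕ) :
    derivative^[k] (X ^ (p * j) * q) = X ^ (p * j) * derivative^[k] q := by
  induction k with
  | zero => rfl
  | succ k ih =>
    rw [Function.iterate_succ_apply', ih, Function.iterate_succ_apply', derivative_mul]
    simp [derivative_X_pow]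

section Stepanov

variable {p : ℕ} [Fact p.Prime]

lemma X_pow_dvd_pow_sub_C (f : (ZMod p)[X]) : X ^ p ∣ f ^ p - C (f.coeff 0) := by
  rw [← ZMod.expand_card f]
  refine ⟨expand (ZMod p) p f.divX, ?_⟩
  have h : expand (ZMod p) p f = expand (ZMod p) p (f.divX * X + C (f.coeff 0)) := by
    rw [divX_mul_X_add]
  rw [h, map_add, map_mul, expand_X, expand_C]
  ring

lemma eq_zero_of_X_pow_dvd_add_mul_pow {f r s : (ZMod p)[X]} {g n m : ℕ} (hg : 2 * g + 1 = p)
    (hf : f.natDegree ≤ m) (hf0 : f.coeff 0 ≠ 0) {α : ZMod p} (hα : Odd (f.rootMultiplicity α))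
    (hr : r.natDegree ≤ n) (hs : s.natDegree ≤ n) (hn : 2 * n + m < p)
    (h : X ^ p ∣ r + s * f ^ g) : r = 0 ∧ s = 0 := by
  have hdvd : X ^ p ∣ r ^ 2 * f - C (f.coeff 0) * s ^ 2 := by
    have h1 : r ^ 2 * f - C (f.coeff 0) * s ^ 2
        = (r + s * f ^ g) * ((r - s * f ^ g) * f) + (f ^ p - C (f.coeff 0)) * s ^ 2 := by
      have h2 : f ^ p = f ^ (2 * g + 1) := by rw [hg]
      rw [h2]
      ring
    rw [h1]
    exact dvd_add (h.mul_right _) ((X_pow_dvd_pow_sub_C f).mul_right _)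
  have hzero : r ^ 2 * f - C (f.coeff 0) * s ^ 2 = 0 := by
    refine eq_zero_of_dvd_of_natDegree_lt hdvd ?_
    rw [natDegree_X_pow]
    refine lt_of_le_of_lt ?_ hn
    refine (natDegree_sub_le _ _).trans (max_le ?_ ?_)
    · refine natDegree_mul_le.trans ?_
      have := natDegree_pow_le (p := r) (n := 2)
      omega
    · refine natDegree_mul_le.trans ?_
      have := natDegree_pow_le (p := s) (n := 2)
      rw [natDegree_C]
      omega
  have heq : r ^ 2 * f = C (f.coeff 0) * s ^ 2 := sub_eq_zero.mp hzero
  have hf' : f ≠ 0 := by rintro rfl; simp at hf0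
  by_cases hr0 : r = 0
  · refine ⟨hr0, ?_⟩
    simp [hr0, hf0] at heq
    exact heq
  · exfalso
    have hlhs : r ^ 2 * f ≠ 0 := mul_ne_zero (pow_ne_zero _ hr0) hf'
    have h1 := congrArg (rootMultiplicity α) heq
    have hs2 := right_ne_zero_of_mul (heq ▸ hlhs)
    rw [rootMultiplicity_mul hlhs, rootMultiplicity_mul (heq ▸ hlhs), sq, sq,
      rootMultiplicity_mul (sq r ▸ pow_ne_zero 2 hr0), rootMultiplicity_mul (sq s ▸ hs2),
      rootMultiplicity_C] at h1
    obtain ⟨k, hk⟩ := hα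
    omega

lemma eq_zero_of_sum_X_pow_mul_eq_zero {f : (ZMod p)[X]} {g n m : ℕ} (hg : 2 * g + 1 = p)
    (hf : f.natDegree ≤ m) (hf0 : f.coeff 0 ≠ 0) {α : ZMod p} (hα : Odd (f.rootMultiplicity α))
    (hn : 2 * n + m < p) {J : ℕ} (r s : Fin J → (ZMod p)[X]) (hr : ∀ j, (r j).natDegree ≤ n)
    (hs : ∀ j, (s j).natDegree ≤ n)
    (h : ∑ j : Fin J, X ^ (p * (j : ℕ)) * (r j + s j * f ^ g) = 0) (j : Fin J) : r j = 0 ∧ s j = 0 := by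
  induction J with
  | zero => exact j.elim0
  | succ J ih =>
    have hsplit : ∑ j : Fin J, X ^ (p * ((j.succ : Fin (J + 1)) : ℕ)) *
          (r j.succ + s j.succ * f ^ g)
        = X ^ p * ∑ j : Fin J, X ^ (p * (j : ℕ)) * (r j.succ + s j.succ * f ^ g) := by
      rw [Finset.mul_sum]
      refine Finset.sum_congr rfl fun j _ => ?_
      rw [Fin.val_succ, Nat.mul_add, pow_add, mul_one, mul_comm (X ^ (p * (j : ℕ))), mul_assoc]
    rw [Fin.sum_univ_succ, hsplit] at h
    simp only [Fin.val_zero, mul_zero, pow_zero, one_mul] at h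
    have h0 : r 0 = 0 ∧ s 0 = 0 := by
      refine eq_zero_of_X_pow_dvd_add_mul_pow hg hf hf0 hα (hr 0) (hs 0) hn ?_
      rw [eq_neg_of_add_eq_zero_left h]
      exact (dvd_mul_right _ _).neg_right
    refine Fin.cases h0 (fun i => ?_) j
    rw [h0.1, h0.2] at h
    simp only [zero_mul, add_zero, zero_add, mul_eq_zero, pow_eq_zero_iff', X_ne_zero, false_and,
      false_or] at h
    exact ih (fun i => r i.succ) (fun i => s i.succ) (fun i => hr _) (fun i => hs _) h i


/-- Stepanov's auxiliary polynomial exists by a dimension count. -/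
lemma exists_auxiliary_coefficients {f : (ZMod p)[X]} {m n ℓ J : ℕ} (hf : f.natDegree ≤ m)
    (a : ZMod p) (e : ℕ) (hdim : ℓ * (J + n + ℓ * m + 1) < 2 * J * (n + 1)) :
    ∃ r s : Fin J → (ZMod p)[X], (∀ j, (r j).natDegree ≤ n) ∧ (∀ j, (s j).natDegree ≤ n) ∧
      (∃ j, r j ≠ 0 ∨ s j ≠ 0) ∧
      ∀ k < ℓ, ∑ j : Fin J, (powDerivCofactor f ℓ k (r j) +
        C a * powDerivCofactor f e k (s j)) * X ^ (j : ℕ) = 0 := by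
  let V := Fin J → (degreeLT (ZMod p) (n + 1) × degreeLT (ZMod p) (n + 1))
  let G : ℕ → V →ₗ[ZMod p] (ZMod p)[X] := fun k => ∑ j : Fin J,
    LinearMap.mulRight (ZMod p) (X ^ (j : ℕ)) ∘ₗ
      ((powDerivCofactor f ℓ k ∘ₗ (degreeLT (ZMod p) (n + 1)).subtype ∘ₗ LinearMap.fst _ _ _ +
        LinearMap.mulLeft (ZMod p) (C a) ∘ₗ powDerivCofactor f e k ∘ₗ
          (degreeLT (ZMod p) (n + 1)).subtype ∘ₗ LinearMap.snd _ _ _) ∘ₗ LinearMap.proj j)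
  let Φ : V →ₗ[ZMod p] (Fin ℓ → Fin (J + n + ℓ * m + 1) → ZMod p) :=
    LinearMap.pi fun k => LinearMap.pi fun i => lcoeff (ZMod p) (i : ℕ) ∘ₗ G k
  have hdegV : Module.finrank (ZMod p) (degreeLT (ZMod p) (n + 1)) = n + 1 := by
    rw [(degreeLTEquiv (ZMod p) (n + 1)).finrank_eq, Module.finrank_fin_fun]
  have : FiniteDimensional (ZMod p) (degreeLT (ZMod p) (n + 1)) :=
    Module.Finite.equiv (degreeLTEquiv (ZMod p) (n + 1)).symm
  have hker : LinearMap.ker Φ ≠ ⊥ := by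
    apply LinearMap.ker_ne_bot_of_finrank_lt
    simp only [V, Module.finrank_pi_fintype, Module.finrank_prod, hdegV, Module.finrank_self,
      Finset.sum_const, Finset.card_univ, Fintype.card_fin, smul_eq_mul, mul_one]
    linarith
  obtain ⟨v, hv, hv0⟩ := Submodule.exists_mem_ne_zero_of_ne_bot hker
  have hdeg : ∀ q : degreeLT (ZMod p) (n + 1), (q : (ZMod p)[X]).natDegree ≤ n := fun q => by
    have h := mem_degreeLT.mp q.2
    exact natDegree_le_iff_degree_le.mpr (Order.lt_succ_iff.mp (by exact_mod_cast h))
  refine ⟨fun j => (v j).1, fun j => (v j).2, fun j => hdeg _, fun j => hdeg _, ?_, ?_⟩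
  · by_contra! hcon
    apply hv0
    ext j : 1
    exact Prod.ext (Subtype.ext (hcon j).1) (Subtype.ext (hcon j).2)
  · intro k hk
    have hG : ∑ j : Fin J, (powDerivCofactor f ℓ k ((v j).1 : (ZMod p)[X]) +
        C a * powDerivCofactor f e k ((v j).2 : (ZMod p)[X])) * X ^ (j : ℕ) = G k v := by
      simp [G]
      rfl
    have hGdeg : (G k v).natDegree ≤ J + n + ℓ * m := by
      rw [← hG]
      refine natDegree_sum_le_of_forall_le _ _ fun j _ => ?_
      refine natDegree_mul_le.trans ?_
      have hkm : k * m ≤ ℓ * m := Nat.mul_le_mul_right _ hk.le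
      have h1 := natDegree_powDerivCofactor_le hf ℓ (hdeg (v j).1) k
      have h2 := natDegree_powDerivCofactor_le hf e (hdeg (v j).2) k
      have h3 : (powDerivCofactor f ℓ k ((v j).1 : (ZMod p)[X]) +
        C a * powDerivCofactor f e k ((v j).2 : (ZMod p)[X])).natDegree ≤ n + ℓ * m :=
        natDegree_add_le_of_degree_le (h1.trans (by omega))
          ((natDegree_C_mul_le _ _).trans (h2.trans (by omega)))
      have := j.2
      rw [natDegree_X_pow]
      omega
    rw [hG]
    ext i
    rw [coeff_zero]
    by_cases hi : i < J + n + ℓ * m + 1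
    · have h := congrFun (congrFun (LinearMap.mem_ker.mp hv) ⟨k, hk⟩) ⟨i, hi⟩
      simpa [Φ] using h
    · exact coeff_eq_zero_of_natDegree_lt (by omega)

lemma card_mul_le_of_stepanov {f : (ZMod p)[X]} {g n m ℓ J : ℕ} (hg : 2 * g + 1 = p)
    (hf : f.natDegree ≤ m) (hf0 : f.coeff 0 ≠ 0) {α : ZMod p} (hα : Odd (f.rootMultiplicity α))
    (hn : 2 * n + m < p) (hℓ : ℓ ≤ p) (hℓ0 : 0 < ℓ)
    (hdim : ℓ * (J + n + ℓ * m + 1) < 2 * J * (n + 1)) (a : ZMod p)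
    (Z : Finset (ZMod p)) (hZ : ∀ x ∈ Z, f.eval x ^ g = a) :
    Z.card * ℓ ≤ p * J + n + (ℓ + g) * m := by
  obtain ⟨r, s, hr, hs, ⟨j₀, hj₀⟩, hrs⟩ := exists_auxiliary_coefficients hf a (ℓ + g) hdim
  let h : Fin J → (ZMod p)[X] := fun j => f ^ ℓ * r j + f ^ (ℓ + g) * s j
  let F : (ZMod p)[X] := ∑ j : Fin J, X ^ (p * (j : ℕ)) * h j
  have hf' : f ≠ 0 := by rintro rfl; simp at hf0
  have hFeq : F = f ^ ℓ * ∑ j : Fin J, X ^ (p * (j : ℕ)) * (r j + s j * f ^ g) := by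
    simp only [F, h, Finset.mul_sum]
    exact Finset.sum_congr rfl fun j _ => by rw [pow_add]; ring
  have hF0 : F ≠ 0 := by
    rw [hFeq]
    refine mul_ne_zero (pow_ne_zero _ hf') fun hzero => ?_
    have := eq_zero_of_sum_X_pow_mul_eq_zero hg hf hf0 hα hn r s hr hs hzero j₀
    tauto
  have hFdeg : F.natDegree ≤ p * J + n + (ℓ + g) * m := by
    refine natDegree_sum_le_of_forall_le _ _ fun j _ => ?_
    refine natDegree_mul_le.trans ?_
    have hj : p * (j : ℕ) ≤ p * J := Nat.mul_le_mul_left _ j.2.le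
    have h1 : ((f ^ ℓ) * r j).natDegree ≤ n + (ℓ + g) * m := by
      refine natDegree_mul_le.trans ?_
      have h2 : (f ^ ℓ).natDegree ≤ (ℓ + g) * m :=
        natDegree_pow_le.trans (Nat.mul_le_mul (by omega) hf)
      have := hr j
      omega
    have h1' : ((f ^ (ℓ + g)) * s j).natDegree ≤ n + (ℓ + g) * m := by
      refine natDegree_mul_le.trans ?_
      have h2 : (f ^ (ℓ + g)).natDegree ≤ (ℓ + g) * m :=
        natDegree_pow_le.trans (Nat.mul_le_mul le_rfl hf)
      have := hs j
      omega
    have h3 := natDegree_add_le_of_degree_le h1 h1'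
    rw [natDegree_X_pow]
    change _ + (h j).natDegree ≤ _
    simp only [h]
    omega
  have hder : ∀ k < ℓ, ∀ x ∈ Z, (derivative^[k] F).IsRoot x := by
    intro k hk x hx
    have hxp : ∀ j : ℕ, x ^ (p * j) = x ^ j := fun j => by rw [pow_mul, ZMod.pow_card]
    have h1 : derivative^[k] F = ∑ j : Fin J, X ^ (p * (j : ℕ)) *
        (f ^ (ℓ - k) * powDerivCofactor f ℓ k (r j) +
          f ^ (ℓ - k) * f ^ g * powDerivCofactor f (ℓ + g) k (s j)) := by
      rw [iterate_derivative_sum]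
      refine Finset.sum_congr rfl fun j _ => ?_
      rw [iterate_derivative_X_pow_mul_of_charP, iterate_map_add,
        iterate_derivative_pow_mul_eq _ _ _ _ hk.le,
        iterate_derivative_pow_mul_eq _ _ _ _ (by omega), ← pow_add]
      congr 4
      omega
    have h2 := congrArg (eval x) (hrs k hk)
    simp only [eval_finsetSum, eval_mul, eval_add, eval_C, eval_pow, eval_X, eval_zero] at h2
    rw [IsRoot, h1]
    simp only [eval_finsetSum, eval_mul, eval_add, eval_pow, eval_X, hxp, hZ x hx]
    rw [← mul_zero (eval x f ^ (ℓ - k)), ← h2, Finset.mul_sum]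
    exact Finset.sum_congr rfl fun j _ => by ring
  have hmult : ∀ x ∈ Z, ℓ ≤ F.rootMultiplicity x := by
    intro x hx
    have := lt_rootMultiplicity_of_isRoot_iterate_derivative_of_mem_nonZeroDivisors' (t := x)
      (n := ℓ - 1) hF0 (fun k hk => hder k (by omega) x hx) (fun k hk hk0 => by
        rw [mem_nonZeroDivisors_iff_ne_zero, Ne, ZMod.natCast_eq_zero_iff]
        exact Nat.not_dvd_of_pos_of_lt (Nat.pos_of_ne_zero hk0) (by omega))
    omega
  calc Z.card * ℓ = ∑ x ∈ Z, ℓ := by simp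
    _ ≤ ∑ x ∈ Z, F.roots.count x := Finset.sum_le_sum fun x hx => by
        rw [count_roots]; exact hmult x hx
    _ ≤ F.roots.card := by
        rw [← Multiset.toFinset_sum_count_eq]
        refine Finset.sum_le_sum_of_subset_of_nonneg (fun x hx => ?_) (fun _ _ _ => Nat.zero_le _)
        rw [Multiset.mem_toFinset, ← Multiset.one_le_count_iff_mem, count_roots]
        exact hℓ0.trans_le (hmult x hx)
    _ ≤ F.natDegree := card_roots' F
    _ ≤ _ := hFdeg

end Stepanov

lemma two_mul_card_le_of_stepanov {p : ℕ} [Fact p.Prime] {f : (ZMod p)[X]} {g m : ℕ}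
    (hg : 2 * g + 1 = p) (hf : f.natDegree ≤ m) (hf0 : f.coeff 0 ≠ 0) {α : ZMod p}
    (hα : Odd (f.rootMultiplicity α)) (hp : 64 ≤ p) (hpm : 4 * m ≤ p) (a : ZMod p)
    (Z : Finset (ZMod p)) (hZ : ∀ x ∈ Z, f.eval x ^ g = a) :
    2 * Z.card ≤ p + (29 * m + 27) * p.sqrt := by
  set t := p.sqrt with ht
  have ht8 : 8 ≤ t := by rw [ht, Nat.le_sqrt]; omega
  have htp : t * t ≤ p := Nat.sqrt_le p
  have hpt : p ≤ t * t + t + t := Nat.sqrt_le_add p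
  obtain ⟨n, hn1, hn2⟩ : ∃ n, 2 * n + m < p ∧ p ≤ 2 * (n + 1) + m :=
    ⟨(p - m - 1) / 2, by omega, by omega⟩
  have hdim : 2 * t * ((t + (8 * m + 8)) + n + 2 * t * m + 1)
      < 2 * (t + (8 * m + 8)) * (n + 1) := by
    have h1 : 3 * p ≤ 8 * (n + 1) := by omega
    have h2 : 8 * t ≤ p := by nlinarith
    have h3 : t * (t + (8 * m + 8) + 2 * t * m) < (8 * m + 8) * (n + 1) := by
      have e1 : t * (t + (8 * m + 8) + 2 * t * m)
          = (1 + 2 * m) * (t * t) + (m + 1) * (8 * t) := by ring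
      have e2 : (8 * m + 8) * (n + 1) = (m + 1) * (8 * (n + 1)) := by ring
      rw [e1, e2]
      have e3 := Nat.mul_le_mul_left (1 + 2 * m) htp
      have e4 := Nat.mul_le_mul_left (m + 1) h2
      have e5 := Nat.mul_le_mul_left (m + 1) h1
      nlinarith
    nlinarith
  have hcount := card_mul_le_of_stepanov hg hf hf0 hα hn1 (ℓ := 2 * t) (by nlinarith) (by omega)
    hdim a Z hZ
  have hnp : n ≤ p := by omega
  have hgp : g * m ≤ p * m := Nat.mul_le_mul_right _ (by omega)
  have h3t : p ≤ 3 * (t * t) := by nlinarith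
  have hfin : t * (2 * Z.card) ≤ t * (p + (29 * m + 27) * t) := by
    have e1 : p * (9 * m + 9) ≤ 3 * (t * t) * (9 * m + 9) := Nat.mul_le_mul_right _ h3t
    nlinarith
  exact Nat.le_of_mul_le_mul_left hfin (by omega)

lemma abs_quadraticChar_le_one {F : Type*} [Field F] [Fintype F] [DecidableEq F] (a : F) :
    |(quadraticChar F a : ℝ)| ≤ 1 := by
  rcases quadraticChar_isQuadratic F a with h | h | h <;> simp [h]

lemma abs_sum_quadraticChar_prod_le_of_zero_notMem {p : ℕ} [Fact p.Prime] (hp2 : p ≠ 2) {m : ℕ}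
    (hp : 64 ≤ p) (hpm : 4 * m ≤ p) {S : Finset (ZMod p)} (hS : S.Nonempty) (hSm : S.card ≤ m)
    (h0 : 0 ∉ S) :
    |∑ x : ZMod p, ∏ s ∈ S, (quadraticChar (ZMod p) (x - s) : ℝ)| ≤ (30 * m + 27) * √p := by
  obtain ⟨g, hg⟩ := (Fact.out : p.Prime).odd_of_ne_two hp2
  let f : (ZMod p)[X] := ∏ s ∈ S, (X - C s)
  have heval : ∀ x, f.eval x = ∏ s ∈ S, (x - s) := fun x => by simp [f, eval_prod]
  have hf : f.natDegree ≤ m := by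
    rw [natDegree_prod_of_monic _ _ fun s _ => monic_X_sub_C s]
    simpa using hSm
  have hf0 : f.coeff 0 ≠ 0 := by
    rw [coeff_zero_eq_eval_zero, heval, Finset.prod_ne_zero_iff]
    intro s hs h
    rw [zero_sub, neg_eq_zero] at h
    exact h0 (h ▸ hs)
  obtain ⟨α, hαS⟩ := hS
  have hα : Odd (f.rootMultiplicity α) := by
    rw [← count_roots]
    simp only [f]
    rw [roots_prod_X_sub_C, Multiset.count_eq_one_of_mem S.nodup hαS]
    exact odd_one
  have hχ : ringChar (ZMod p) ≠ 2 := by rwa [ZMod.ringChar_zmod_n]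
  have hhalf : Fintype.card (ZMod p) / 2 = g := by rw [ZMod.card]; omega
  have hprod : ∀ x, ∏ s ∈ S, (quadraticChar (ZMod p) (x - s) : ℝ)
      = (quadraticChar (ZMod p) (f.eval x) : ℝ) := fun x => by
    rw [heval, map_prod, Int.cast_prod]
  let Z : ℤ → Finset (ZMod p) := fun a => Finset.univ.filter fun x =>
    quadraticChar (ZMod p) (f.eval x) = a
  have hZ : ∀ a : ℤ, 2 * (Z a).card ≤ p + (29 * m + 27) * p.sqrt := fun a => by
    refine two_mul_card_le_of_stepanov hg.symm hf hf0 hα hp hpm (a : ZMod p) (Z a) fun x hx => ?_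
    rw [← (Finset.mem_filter.mp hx).2, quadraticChar_eq_pow_of_char_ne_two' hχ, hhalf]
  have hZ0 : (Z 0).card ≤ m := by
    refine le_trans (Finset.card_le_card fun x hx => ?_) hSm
    have := (Finset.mem_filter.mp hx).2
    rw [quadraticChar_eq_zero_iff, heval, Finset.prod_eq_zero_iff] at this
    obtain ⟨s, hs, h⟩ := this
    rwa [sub_eq_zero.mp h]
  have hpt : ∀ x : ZMod p, (1 : ℝ) = (if x ∈ Z 1 then 1 else 0) + (if x ∈ Z (-1) then 1 else 0)
      + (if x ∈ Z 0 then 1 else 0) ∧ (quadraticChar (ZMod p) (f.eval x) : ℝ)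
        = (if x ∈ Z 1 then 1 else 0) - (if x ∈ Z (-1) then 1 else 0) := fun x => by
    simp only [Z, Finset.mem_filter, Finset.mem_univ, true_and]
    rcases quadraticChar_isQuadratic (ZMod p) (f.eval x) with h | h | h <;> norm_num [h]
  have hsum : ∀ a, ∑ x : ZMod p, (if x ∈ Z a then (1 : ℝ) else 0) = (Z a).card := fun a => by
    simp
  have htotal : (p : ℝ) = (Z 1).card + (Z (-1)).card + (Z 0).card := by
    rw [← hsum, ← hsum, ← hsum, ← Finset.sum_add_distrib, ← Finset.sum_add_distrib,
      ← Finset.sum_congr rfl fun x _ => (hpt x).1]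
    simp
  have hdiff : ∑ x : ZMod p, ∏ s ∈ S, (quadraticChar (ZMod p) (x - s) : ℝ)
      = (Z 1).card - (Z (-1)).card := by
    rw [← hsum, ← hsum, ← Finset.sum_sub_distrib]
    exact Finset.sum_congr rfl fun x _ => by rw [hprod, (hpt x).2]
  have hsqrt : (p.sqrt : ℝ) ≤ √p := Real.nat_sqrt_le_real_sqrt
  have h1 : (2 * (Z 1).card : ℝ) ≤ p + (29 * m + 27) * p.sqrt := by exact_mod_cast hZ 1
  have h2 : (2 * (Z (-1)).card : ℝ) ≤ p + (29 * m + 27) * p.sqrt := by exact_mod_cast hZ (-1)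
  have h3 : ((Z 0).card : ℝ) ≤ m := by exact_mod_cast hZ0
  have h4 : (1 : ℝ) ≤ √p := Real.one_le_sqrt.mpr (by exact_mod_cast (by omega : 1 ≤ p))
  have h5 : (29 * m + 27 : ℝ) * p.sqrt ≤ (29 * m + 27) * √p := by gcongr
  have h6 : (m : ℝ) * 1 ≤ m * √p := by gcongr
  rw [hdiff, abs_le]
  constructor <;> nlinarith

/-- The Weil bound, with an unspecified constant, for the quadratic character at a product of
distinct linear factors. -/
theorem abs_sum_quadraticChar_prod_le {p : ℕ} [Fact p.Prime] (hp2 : p ≠ 2) {m : ℕ}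
    {S : Finset (ZMod p)} (hS : S.Nonempty) (hSm : S.card ≤ m) :
    |∑ x : ZMod p, ∏ s ∈ S, (quadraticChar (ZMod p) (x - s) : ℝ)| ≤ (30 * m + 64) * √p := by
  by_cases hbig : 64 ≤ p ∧ 4 * m ≤ p
  · obtain ⟨c, hc⟩ : ∃ c, c ∉ S := by
      by_contra! hcon
      have h1 : S.card = p := by
        rw [Finset.eq_univ_iff_forall.mpr hcon, Finset.card_univ, ZMod.card]
      omega
    have hinj : Function.Injective fun s : ZMod p => s - c := sub_left_injective
    have h := abs_sum_quadraticChar_prod_le_of_zero_notMem hp2 hbig.1 hbig.2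
      (S := S.image fun s => s - c) (hS.image _) (Finset.card_image_le.trans hSm) (by
        simp only [Finset.mem_image, not_exists, not_and, sub_eq_zero]
        rintro s hs rfl
        exact hc hs)
    rw [← Equiv.sum_comp (Equiv.addRight c)]
    simp only [Finset.prod_image hinj.injOn] at h
    simp only [Equiv.coe_addRight]
    refine le_trans (le_of_eq ?_) (h.trans ?_)
    · congr! 5 with x _ s _
      ring
    · gcongr
      norm_num
  · have hp1 : (1 : ℝ) ≤ p := by exact_mod_cast (Fact.out : p.Prime).one_le
    have h1 : |∑ x : ZMod p, ∏ s ∈ S, (quadraticChar (ZMod p) (x - s) : ℝ)| ≤ p := by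
      refine (Finset.abs_sum_le_sum_abs _ _).trans ?_
      have : ∑ x : ZMod p, |∏ s ∈ S, (quadraticChar (ZMod p) (x - s) : ℝ)|
          ≤ ∑ x : ZMod p, 1 := by
        refine Finset.sum_le_sum fun x _ => ?_
        rw [Finset.abs_prod]
        exact Finset.prod_le_one (fun _ _ => abs_nonneg _) fun _ _ => abs_quadraticChar_le_one _
      simpa using this
    have h2 : (p : ℝ) ≤ 4 * m + 64 := by
      have : p ≤ 4 * m + 64 := by omega
      exact_mod_cast this
    have h3 : (1 : ℝ) ≤ √p := Real.one_le_sqrt.mpr hp1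
    have h4 : (0 : ℝ) ≤ m := m.cast_nonneg
    nlinarith

/-- The quadratic character modulo `p`, with real values. -/
noncomputable def realQuadraticChar (p : ℕ) [Fact p.Prime] (x : ZMod p) : ℝ :=
  (quadraticChar (ZMod p) x : ℝ)

section Moments

variable {p : ℕ} [Fact p.Prime]

lemma realQuadraticChar_mul (x y : ZMod p) :
    realQuadraticChar p (x * y) = realQuadraticChar p x * realQuadraticChar p y := by
  rw [realQuadraticChar, map_mul, Int.cast_mul, realQuadraticChar, realQuadraticChar]

lemma abs_realQuadraticChar_le_one (x : ZMod p) : |realQuadraticChar p x| ≤ 1 :=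
  abs_quadraticChar_le_one x

lemma realQuadraticChar_zero : realQuadraticChar p 0 = 0 := by
  simp [realQuadraticChar]

lemma realQuadraticChar_sq {x : ZMod p} (hx : x ≠ 0) : realQuadraticChar p x ^ 2 = 1 := by
  rw [realQuadraticChar]
  exact_mod_cast quadraticChar_sq_one hx

lemma abs_prod_realQuadraticChar_le_one {ι : Type*} (s : Finset ι) (b : ι → ZMod p) :
    |∏ i ∈ s, realQuadraticChar p (b i)| ≤ 1 := by
  rw [Finset.abs_prod]
  exact Finset.prod_le_one (fun _ _ => abs_nonneg _) fun _ _ => abs_realQuadraticChar_le_one _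

lemma abs_sum_prod_realQuadraticChar_le (hp2 : p ≠ 2) {k : ℕ} (b : Fin k → ZMod p)
    (hodd : ∃ c, Odd (Finset.univ.filter fun i => b i = c).card) :
    |∑ x : ZMod p, ∏ i, realQuadraticChar p (x + b i)| ≤ (31 * k + 64) * √p := by
  set n : ZMod p → ℕ := fun c => (Finset.univ.filter fun i => b i = c).card with hn
  set T : Finset (ZMod p) := Finset.univ.image b with hT
  set O : Finset (ZMod p) := T.filter fun c => Odd (n c) with hO
  have hn0 : ∀ c ∈ T, n c ≠ 0 := by
    intro c hc
    obtain ⟨i, -, rfl⟩ := Finset.mem_image.mp hc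
    exact Finset.card_ne_zero_of_mem (Finset.mem_filter.mpr ⟨Finset.mem_univ i, rfl⟩)
  have hOne : O.Nonempty := by
    obtain ⟨c, hc⟩ := hodd
    refine ⟨c, Finset.mem_filter.mpr ⟨?_, hc⟩⟩
    obtain ⟨i, hi⟩ := Finset.card_pos.mp hc.pos
    exact Finset.mem_image.mpr ⟨i, Finset.mem_univ i, (Finset.mem_filter.mp hi).2⟩
  have hTk : T.card ≤ k := Finset.card_image_le.trans (by simp)
  have hOk : O.card ≤ k := (Finset.card_filter_le _ _).trans hTk
  have hprod : ∀ x, ∏ i, realQuadraticChar p (x + b i)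
      = ∏ c ∈ T, realQuadraticChar p (x + c) ^ n c := fun x =>
    Finset.prod_comp (fun c => realQuadraticChar p (x + c)) b
  have hpt : ∀ x, |∏ i, realQuadraticChar p (x + b i) - ∏ c ∈ O, realQuadraticChar p (x + c)|
      ≤ if x ∈ T.image Neg.neg then 1 else 0 := by
    intro x
    split_ifs with hx
    · obtain ⟨c, hc, rfl⟩ := Finset.mem_image.mp hx
      have hz : ∏ c' ∈ T, realQuadraticChar p (-c + c') ^ n c' = 0 :=
        Finset.prod_eq_zero hc (by
          rw [neg_add_cancel, realQuadraticChar_zero, zero_pow (hn0 c hc)])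
      rw [hprod, hz, zero_sub, abs_neg]
      exact abs_prod_realQuadraticChar_le_one _ _
    · refine le_of_eq ?_
      rw [hprod, hO, Finset.prod_filter, abs_eq_zero, sub_eq_zero]
      refine Finset.prod_congr rfl fun c hc => ?_
      have hxc : x + c ≠ 0 := fun h =>
        hx (Finset.mem_image.mpr ⟨c, hc, (eq_neg_of_add_eq_zero_left h).symm⟩)
      have hsq := realQuadraticChar_sq hxc
      split_ifs with ho
      · obtain ⟨j, hj⟩ := ho
        rw [hj, pow_add, pow_mul, hsq, one_pow, one_mul, pow_one]
      · obtain ⟨j, hj⟩ := Nat.not_odd_iff_even.mp ho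
        rw [hj, ← two_mul, pow_mul, hsq, one_pow]
  have hdiff : |∑ x, ∏ i, realQuadraticChar p (x + b i)
      - ∑ x, ∏ c ∈ O, realQuadraticChar p (x + c)| ≤ k := by
    rw [← Finset.sum_sub_distrib]
    refine (Finset.abs_sum_le_sum_abs _ _).trans ((Finset.sum_le_sum fun x _ => hpt x).trans ?_)
    simp only [Finset.sum_ite_mem, Finset.univ_inter, Finset.sum_const, nsmul_eq_mul, mul_one]
    exact_mod_cast Finset.card_image_le.trans hTk
  have hweil := abs_sum_quadraticChar_prod_le hp2 (hOne.image Neg.neg)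
    (Finset.card_image_le.trans hOk)
  simp only [Finset.prod_image neg_injective.injOn, sub_neg_eq_add] at hweil
  change |∑ x, ∏ c ∈ O, realQuadraticChar p (x + c)| ≤ _ at hweil
  have hp1 : (1 : ℝ) ≤ √p :=
    Real.one_le_sqrt.mpr (by exact_mod_cast (Fact.out : p.Prime).one_le)
  have hk : (k : ℝ) * 1 ≤ k * √p := by gcongr
  have htri := abs_add_le (∑ x, ∏ i, realQuadraticChar p (x + b i)
      - ∑ x, ∏ c ∈ O, realQuadraticChar p (x + c)) (∑ x, ∏ c ∈ O, realQuadraticChar p (x + c))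
  rw [sub_add_cancel] at htri
  linarith

end Moments

lemma card_filter_forall_even_fiber_le (B r : ℕ) :
    (Finset.univ.filter fun b : Fin (2 * r) → Fin B =>
      ∀ c, ¬ Odd (Finset.univ.filter fun i => b i = c).card).card ≤ B ^ r * r ^ (2 * r) := by
  classical
  have hcard : (Finset.univ : Finset ((Fin r → Fin B) × (Fin (2 * r) → Fin r))).card
      = B ^ r * r ^ (2 * r) := by simp
  rw [← hcard]
  refine le_trans (Finset.card_le_card fun b hb => ?_)
    (Finset.card_image_le (f := fun uv : (Fin r → Fin B) × (Fin (2 * r) → Fin r) => uv.1 ∘ uv.2))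
  have heven := (Finset.mem_filter.mp hb).2
  rcases Nat.eq_zero_or_pos r with rfl | hr
  · exact Finset.mem_image.mpr ⟨(Fin.elim0, Fin.elim0), Finset.mem_univ _,
      funext fun i => i.elim0⟩
  have himg : (Finset.univ.image b).card ≤ r := by
    have h1 := Finset.card_eq_sum_card_image b (Finset.univ : Finset (Fin (2 * r)))
    have h2 : ∑ c ∈ Finset.univ.image b, 2
        ≤ ∑ c ∈ Finset.univ.image b, (Finset.univ.filter fun i => b i = c).card := by
      refine Finset.sum_le_sum fun c hc => ?_
      obtain ⟨i, -, rfl⟩ := Finset.mem_image.mp hc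
      have h3 : 0 < (Finset.univ.filter fun j => b j = b i).card :=
        Finset.card_pos.mpr ⟨i, by simp⟩
      obtain ⟨j, hj⟩ := Nat.not_odd_iff_even.mp (heven (b i))
      omega
    simp only [Finset.card_univ, Fintype.card_fin] at h1
    rw [Finset.sum_const, smul_eq_mul] at h2
    omega
  let e := (Finset.univ.image b).equivFin
  let i₀ : Fin (2 * r) := ⟨0, by omega⟩
  let v : Fin (2 * r) → Fin r := fun i =>
    Fin.castLE himg (e ⟨b i, Finset.mem_image_of_mem b (Finset.mem_univ i)⟩)
  let u : Fin r → Fin B := fun j =>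
    if h : (j : ℕ) < (Finset.univ.image b).card then (e.symm ⟨j, h⟩ : Fin B) else b i₀
  refine Finset.mem_image.mpr ⟨(u, v), Finset.mem_univ _, funext fun i => ?_⟩
  simp [u, v]

theorem sum_pow_shifted_sum_realQuadraticChar_le {p : ℕ} [Fact p.Prime] (hp2 : p ≠ 2) {B : ℕ}
    (hB : B ≤ p) (r : ℕ) :
    ∑ x : ZMod p, (∑ b ∈ Finset.range B, realQuadraticChar p (x + b)) ^ (2 * r)
      ≤ r ^ (2 * r) * B ^ r * p + (62 * r + 64) * B ^ (2 * r) * √p := by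
  classical
  have hexp : ∀ x : ZMod p, (∑ b ∈ Finset.range B, realQuadraticChar p (x + b)) ^ (2 * r)
      = ∑ b : Fin (2 * r) → Fin B, ∏ i, realQuadraticChar p (x + ((b i : ℕ) : ZMod p)) := by
    intro x
    rw [← Fin.sum_univ_eq_sum_range (fun b => realQuadraticChar p (x + b)), Finset.sum_pow',
      Fintype.piFinset_univ]
  simp only [hexp]
  rw [Finset.sum_comm]
  set E := Finset.univ.filter fun b : Fin (2 * r) → Fin B =>
      ∀ c, ¬ Odd (Finset.univ.filter fun i => b i = c).card with hE
  have hinj : ∀ c c' : Fin B, ((c : ℕ) : ZMod p) = ((c' : ℕ) : ZMod p) → c = c' := by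
    intro c c' h
    have h1 := (ZMod.natCast_eq_natCast_iff' _ _ _).mp h
    rw [Nat.mod_eq_of_lt (c.2.trans_le hB), Nat.mod_eq_of_lt (c'.2.trans_le hB)] at h1
    exact Fin.ext h1
  have hbound : ∀ b : Fin (2 * r) → Fin B,
      ∑ x : ZMod p, ∏ i, realQuadraticChar p (x + ((b i : ℕ) : ZMod p))
        ≤ (if b ∈ E then (p : ℝ) else 0) + (62 * r + 64) * √p := by
    intro b
    split_ifs with hb
    · have h1 : ∑ x : ZMod p, ∏ i, realQuadraticChar p (x + ((b i : ℕ) : ZMod p))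
          ≤ ∑ x : ZMod p, 1 :=
        Finset.sum_le_sum fun x _ => (le_abs_self _).trans (abs_prod_realQuadraticChar_le_one _ _)
      simp only [Finset.sum_const, Finset.card_univ, ZMod.card, nsmul_eq_mul, mul_one] at h1
      have : 0 ≤ (62 * r + 64) * √(p : ℝ) := by positivity
      linarith
    · simp only [hE, Finset.mem_filter, Finset.mem_univ, true_and, not_forall, not_not] at hb
      obtain ⟨c, hc⟩ := hb
      have h1 := abs_sum_prod_realQuadraticChar_le hp2 (fun i => ((b i : ℕ) : ZMod p))
        ⟨((c : ℕ) : ZMod p), by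
          convert hc using 3
          exact ⟨hinj _ _, fun h => by rw [h]⟩⟩
      have h2 := (le_abs_self _).trans h1
      push_cast at h2
      linarith
  refine (Finset.sum_le_sum fun b _ => hbound b).trans ?_
  rw [Finset.sum_add_distrib, Finset.sum_ite_mem, Finset.univ_inter, Finset.sum_const,
    Finset.sum_const, Finset.card_univ, Fintype.card_fun, Fintype.card_fin, Fintype.card_fin,
    nsmul_eq_mul, nsmul_eq_mul]
  have hEcard : (E.card : ℝ) ≤ B ^ r * r ^ (2 * r) := by
    exact_mod_cast card_filter_forall_even_fiber_le B r
  have hp0 : (0 : ℝ) ≤ p := p.cast_nonneg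
  have := mul_le_mul_of_nonneg_right hEcard hp0
  push_cast
  linarith

lemma card_pairs_mul_le {p : ℕ} (M : ZMod p) {A N a a' : ℕ} (hAN : 2 * A * N ≤ p)
    (ha : a ∈ Finset.Icc 1 A) (ha' : a' ∈ Finset.Icc 1 A) :
    ((Finset.range N ×ˢ Finset.range N).filter fun w =>
      (M + (w.1 : ℕ)) * a' = (M + (w.2 : ℕ)) * a).card * a ≤ N * Nat.gcd a a' + a := by
  rw [Finset.mem_Icc] at ha ha'
  set W := (Finset.range N ×ˢ Finset.range N).filter fun w =>
      (M + (w.1 : ℕ)) * a' = (M + (w.2 : ℕ)) * a with hW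
  set g := Nat.gcd a a' with hg
  have hg0 : 0 < g := Nat.gcd_pos_of_pos_left _ ha.1
  obtain ⟨q, hq⟩ : g ∣ a := Nat.gcd_dvd_left a a'
  obtain ⟨q', hq'⟩ : g ∣ a' := Nat.gcd_dvd_right a a'
  have hq0 : 0 < q := Nat.pos_of_ne_zero fun h => by simp [h] at hq; omega
  have hcop : IsCoprime (q : ℤ) q' := by
    rw [Nat.isCoprime_iff_coprime]
    have h := Nat.coprime_div_gcd_div_gcd (m := a) (n := a') hg0
    rw [← hg] at h
    rwa [hq, hq', Nat.mul_div_cancel_left _ hg0, Nat.mul_div_cancel_left _ hg0] at h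
  have hlin : ∀ w ∈ W, ∀ v ∈ W, ((w.1 : ℤ) - v.1) * q' = ((w.2 : ℤ) - v.2) * q := by
    intro w hw v hv
    simp only [hW, Finset.mem_filter, Finset.mem_product, Finset.mem_range] at hw hv
    obtain ⟨⟨hw1, hw2⟩, hw⟩ := hw
    obtain ⟨⟨hv1, hv2⟩, hv⟩ := hv
    have hmod : ((((w.1 : ℤ) - v.1) * a' - ((w.2 : ℤ) - v.2) * a : ℤ) : ZMod p) = 0 := by
      push_cast
      linear_combination hw - hv
    have hdvd := (ZMod.intCast_zmod_eq_zero_iff_dvd _ _).mp hmod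
    have hbd : ∀ {x y : ℕ} {b : ℕ}, x < N → y < N → 1 ≤ b → b ≤ A →
        |((x : ℤ) - y) * b| < A * N := by
      intro x y b hx hy hb1 hb
      rw [abs_mul, Nat.abs_cast]
      have h1 : |(x : ℤ) - y| < N := by rw [abs_lt]; constructor <;> omega
      have hb' : (b : ℤ) ≤ A := by exact_mod_cast hb
      have hb1' : (1 : ℤ) ≤ b := by exact_mod_cast hb1
      have h0 := abs_nonneg ((x : ℤ) - y)
      nlinarith
    have hlt : |((w.1 : ℤ) - v.1) * a' - ((w.2 : ℤ) - v.2) * a| < p := by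
      have e1 := hbd hw1 hv1 ha'.1 ha'.2
      have e2 := hbd hw2 hv2 ha.1 ha.2
      have e3 := abs_sub (((w.1 : ℤ) - v.1) * a') (((w.2 : ℤ) - v.2) * a)
      have e4 : (2 * A * N : ℤ) ≤ p := by exact_mod_cast hAN
      linarith
    have hz := Int.eq_zero_of_abs_lt_dvd hdvd hlt
    rw [hq, hq'] at hz
    push_cast at hz
    have hg0' : (g : ℤ) ≠ 0 := by exact_mod_cast hg0.ne'
    apply mul_left_cancel₀ hg0'
    linear_combination hz
  have hcard : W.card ≤ (Finset.range ((N - 1) / q + 1)).card := by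
    refine Finset.card_le_card_of_injOn (fun w => w.1 / q) ?_ ?_
    · intro w hw
      have hw' : w ∈ W := hw
      simp only [hW, Finset.mem_filter, Finset.mem_product, Finset.mem_range] at hw'
      simp only [Finset.coe_range, Set.mem_Iio]
      exact Nat.lt_succ_of_le (Nat.div_le_div_right (by omega))
    · intro w hw v hv hwv
      have h := hlin w hw v hv
      have hdvd : (q : ℤ) ∣ (w.1 : ℤ) - v.1 :=
        hcop.dvd_of_dvd_mul_right ⟨(w.2 : ℤ) - v.2, by rw [h]; ring⟩
      have hmod : w.1 % q = v.1 % q :=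
        ((Nat.modEq_iff_dvd).mpr hdvd).symm
      have h1 : w.1 = v.1 := by
        rw [← Nat.div_add_mod w.1 q, ← Nat.div_add_mod v.1 q, hmod]
        simp only at hwv
        rw [hwv]
      rw [h1, sub_self, zero_mul] at h
      have hq0' : (q : ℤ) ≠ 0 := by exact_mod_cast hq0.ne'
      have h2 := (mul_eq_zero.mp h.symm).resolve_right hq0'
      exact Prod.ext h1 (by omega)
  rw [Finset.card_range] at hcard
  have h1 : (N - 1) / q * q ≤ N := (Nat.div_mul_le_self _ _).trans (Nat.sub_le _ _)
  calc W.card * a ≤ ((N - 1) / q + 1) * a := Nat.mul_le_mul_right _ hcard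
    _ = ((N - 1) / q * q) * g + a := by rw [hq]; ring
    _ ≤ N * g + a := by gcongr

lemma sum_gcd_div_le (A : ℕ) :
    ∑ a ∈ Finset.Icc 1 A, ∑ a' ∈ Finset.Icc 1 A, (Nat.gcd a a' : ℝ) / a
      ≤ A * (∑ d ∈ Finset.Icc 1 A, (1 : ℝ) / d) ^ 2 := by
  set H := ∑ d ∈ Finset.Icc 1 A, (1 : ℝ) / d with hH
  have hgcd : ∀ a ∈ Finset.Icc 1 A, ∀ a' ∈ Finset.Icc 1 A, (Nat.gcd a a' : ℝ) / a
      ≤ ∑ d ∈ Finset.Icc 1 A,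
        (if d ∣ a then (d : ℝ) / a else 0) * (if d ∣ a' then 1 else 0) := by
    intro a ha a' ha'
    rw [Finset.mem_Icc] at ha ha'
    have hmem : Nat.gcd a a' ∈ Finset.Icc 1 A := Finset.mem_Icc.mpr
      ⟨Nat.gcd_pos_of_pos_left _ ha.1, (Nat.gcd_le_left _ ha.1).trans ha.2⟩
    have h := Finset.single_le_sum (f := fun d : ℕ =>
      (if d ∣ a then (d : ℝ) / a else 0) * (if d ∣ a' then 1 else 0))
      (fun d _ => by positivity) hmem
    simpa [Nat.gcd_dvd_left, Nat.gcd_dvd_right] using h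
  have hmul : ∀ d ∈ Finset.Icc 1 A, ∑ a ∈ Finset.Icc 1 A, (if d ∣ a then (d : ℝ) / a else 0)
      ≤ H := by
    intro d hd
    rw [Finset.mem_Icc] at hd
    rw [← Finset.sum_filter]
    have hsub : (Finset.Icc 1 A).filter (d ∣ ·) ⊆ (Finset.Icc 1 A).image (d * ·) := by
      intro a ha
      rw [Finset.mem_filter, Finset.mem_Icc] at ha
      obtain ⟨⟨h1, h2⟩, k, rfl⟩ := ha
      refine Finset.mem_image.mpr ⟨k, Finset.mem_Icc.mpr ⟨?_, ?_⟩, rfl⟩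
      · exact Nat.pos_of_ne_zero fun h => by simp [h] at h1
      · exact (Nat.le_mul_of_pos_left k hd.1).trans h2
    refine (Finset.sum_le_sum_of_subset_of_nonneg hsub fun _ _ _ => by positivity).trans ?_
    have hd0 : (d : ℝ) ≠ 0 := by exact_mod_cast (by omega : d ≠ 0)
    rw [Finset.sum_image fun x _ y _ h => Nat.eq_of_mul_eq_mul_left hd.1 h, hH]
    refine le_of_eq (Finset.sum_congr rfl fun k _ => ?_)
    push_cast
    rw [div_mul_eq_div_div, div_self hd0]
  have hcount : ∀ d ∈ Finset.Icc 1 A, ∑ a' ∈ Finset.Icc 1 A, (if d ∣ a' then (1 : ℝ) else 0)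
      ≤ A * (1 / d) := by
    intro d hd
    rw [← Finset.sum_filter, Finset.sum_const, nsmul_eq_mul, mul_one]
    have h := Nat.Ioc_filter_dvd_card_eq_div A d
    have h2 : Finset.Icc 1 A = Finset.Ioc 0 A := rfl
    rw [h2, h, mul_one_div]
    exact Nat.cast_div_le
  calc ∑ a ∈ Finset.Icc 1 A, ∑ a' ∈ Finset.Icc 1 A, (Nat.gcd a a' : ℝ) / a
      ≤ ∑ a ∈ Finset.Icc 1 A, ∑ a' ∈ Finset.Icc 1 A, ∑ d ∈ Finset.Icc 1 A,
        (if d ∣ a then (d : ℝ) / a else 0) * (if d ∣ a' then 1 else 0) :=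
        Finset.sum_le_sum fun a ha => Finset.sum_le_sum fun a' ha' => hgcd a ha a' ha'
    _ = ∑ d ∈ Finset.Icc 1 A, (∑ a ∈ Finset.Icc 1 A, (if d ∣ a then (d : ℝ) / a else 0)) *
        ∑ a' ∈ Finset.Icc 1 A, (if d ∣ a' then 1 else 0) := by
        simp_rw [Finset.sum_mul_sum]
        rw [Finset.sum_comm]
        conv_rhs => rw [Finset.sum_comm]
        rw [Finset.sum_comm]
        exact Finset.sum_congr rfl fun a _ => Finset.sum_comm
    _ ≤ ∑ d ∈ Finset.Icc 1 A, H * (A * (1 / d)) := by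
        refine Finset.sum_le_sum fun d hd => ?_
        have hH0 : 0 ≤ H := Finset.sum_nonneg fun _ _ => by positivity
        exact mul_le_mul (hmul d hd) (hcount d hd)
          (Finset.sum_nonneg fun _ _ => by positivity) hH0
    _ = A * H ^ 2 := by rw [← Finset.mul_sum, ← Finset.mul_sum, ← hH]; ring

lemma sum_sq_card_fiber_quotient_le {p : ℕ} [Fact p.Prime] (M : ZMod p) {A N : ℕ}
    (hA : 1 ≤ A) (hAN : 2 * A * N ≤ p) (hle : A ≤ N) :
    ∑ x : ZMod p, (((Finset.Icc 1 A ×ˢ Finset.range N).filter fun u =>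
      (M + (u.2 : ℕ)) / (u.1 : ℕ) = x).card : ℝ) ^ 2
      ≤ 2 * A * N * (∑ d ∈ Finset.Icc 1 A, (1 : ℝ) / d) ^ 2 := by
  set H := ∑ d ∈ Finset.Icc 1 A, (1 : ℝ) / d with hH
  set φ : ℕ × ℕ → ZMod p := fun u => (M + (u.2 : ℕ)) / (u.1 : ℕ) with hφ
  have hne : ∀ a ∈ Finset.Icc 1 A, (a : ZMod p) ≠ 0 := by
    intro a ha h
    rw [Finset.mem_Icc] at ha
    rw [ZMod.natCast_eq_zero_iff] at h
    have := Nat.le_of_dvd ha.1 h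
    nlinarith
  have h1 : ∀ x : ZMod p, (((Finset.Icc 1 A ×ˢ Finset.range N).filter fun u => φ u = x).card : ℝ)
      = ∑ a ∈ Finset.Icc 1 A, ∑ i ∈ Finset.range N, if φ (a, i) = x then 1 else 0 := by
    intro x
    rw [Finset.card_filter, Finset.sum_product]
    push_cast
    rfl
  have h2 : ∑ x : ZMod p, (((Finset.Icc 1 A ×ˢ Finset.range N).filter
        fun u => φ u = x).card : ℝ) ^ 2
      = ∑ a ∈ Finset.Icc 1 A, ∑ a' ∈ Finset.Icc 1 A,
        (((Finset.range N ×ˢ Finset.range N).filter fun w =>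
          (M + (w.1 : ℕ)) * a' = (M + (w.2 : ℕ)) * a).card : ℝ) := by
    simp_rw [sq, h1, Finset.sum_mul_sum]
    rw [Finset.sum_comm]
    refine Finset.sum_congr rfl fun a ha => ?_
    rw [Finset.sum_comm]
    refine Finset.sum_congr rfl fun a' ha' => ?_
    rw [Finset.sum_comm, Finset.card_filter, Finset.sum_product]
    push_cast
    refine Finset.sum_congr rfl fun i _ => ?_
    rw [Finset.sum_comm]
    refine Finset.sum_congr rfl fun i' _ => ?_
    simp only [mul_ite, mul_one, mul_zero]
    have h3 : φ (a, i) = φ (a', i') ↔ (M + (i : ℕ)) * a' = (M + (i' : ℕ)) * a := by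
      simp only [hφ]
      rw [div_eq_div_iff (hne a ha) (hne a' ha')]
    simp only [← h3]
    simp [eq_comm]
  rw [h2]
  have h4 : ∀ a ∈ Finset.Icc 1 A, ∀ a' ∈ Finset.Icc 1 A,
      (((Finset.range N ×ˢ Finset.range N).filter fun w =>
          (M + (w.1 : ℕ)) * a' = (M + (w.2 : ℕ)) * a).card : ℝ)
        ≤ N * ((Nat.gcd a a' : ℝ) / a) + 1 := by
    intro a ha a' ha'
    have h := card_pairs_mul_le M hAN ha ha'
    have ha0 : (0 : ℝ) < a := by exact_mod_cast (Finset.mem_Icc.mp ha).1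
    rw [← mul_le_mul_iff_left₀ ha0]
    have h5 : (N * ((Nat.gcd a a' : ℝ) / a) + 1) * a = N * Nat.gcd a a' + a := by
      field_simp
    rw [h5]
    exact_mod_cast h
  refine (Finset.sum_le_sum fun a ha => Finset.sum_le_sum fun a' ha' => h4 a ha a' ha').trans ?_
  simp only [Finset.sum_add_distrib, ← Finset.mul_sum, Finset.sum_const, Nat.card_Icc,
    Nat.add_sub_cancel, nsmul_eq_mul, mul_one]
  have h6 := mul_le_mul_of_nonneg_left (sum_gcd_div_le A) (N.cast_nonneg (α := ℝ))
  rw [← hH] at h6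
  have h7 : 1 ≤ H := by
    have := Finset.single_le_sum (f := fun d : ℕ => (1 : ℝ) / d) (fun _ _ => by positivity)
      (Finset.mem_Icc.mpr ⟨le_rfl, hA⟩)
    simpa [hH] using this
  have h8 : (A : ℝ) * A ≤ A * N * H ^ 2 := by
    have e1 : (A : ℝ) ≤ N := by exact_mod_cast hle
    have e2 : 1 ≤ H ^ 2 := one_le_pow₀ h7
    have e3 : (0 : ℝ) ≤ A := A.cast_nonneg
    have e4 : (A : ℝ) * A ≤ A * N := by gcongr
    nlinarith [mul_nonneg e3 (N.cast_nonneg (α := ℝ))]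
  linarith

/-- Sum of the quadratic character modulo `p` over `N` consecutive residues from `M` on. -/
noncomputable def shortCharSum (p : ℕ) [Fact p.Prime] (M : ZMod p) (N : ℕ) : ℝ :=
  ∑ i ∈ Finset.range N, realQuadraticChar p (M + i)

section Burgess

variable {p : ℕ} [Fact p.Prime]

lemma abs_shortCharSum_le (M : ZMod p) (N : ℕ) : |shortCharSum p M N| ≤ N := by
  refine (Finset.abs_sum_le_sum_abs _ _).trans
    ((Finset.sum_le_sum fun i _ => abs_realQuadraticChar_le_one _).trans ?_)
  simp

lemma shortCharSum_add (M : ZMod p) (N N' : ℕ) :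
    shortCharSum p M (N + N') = shortCharSum p M N + shortCharSum p (M + N) N' := by
  simp [shortCharSum, Finset.sum_range_add, add_assoc]

/-- The mean over multiplicative shifts that controls a short character sum. -/
noncomputable def shiftedMean (p : ℕ) [Fact p.Prime] (M : ZMod p) (A B N : ℕ) : ℝ :=
  ∑ u ∈ Finset.Icc 1 A ×ˢ Finset.range N,
    |∑ b ∈ Finset.range B, realQuadraticChar p ((M + (u.2 : ℕ)) / (u.1 : ℕ) + b)|

lemma mul_abs_shortCharSum_le (M : ZMod p) {A B N : ℕ} (hAp : A < p) {E : ℝ}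
    (hE : ∀ M' : ZMod p, ∀ h ≤ A * B, |shortCharSum p M' h| ≤ E) :
    (A * B) * |shortCharSum p M N| ≤ shiftedMean p M A B N + (A * B) * (2 * E) := by
  have hshift : ∀ h : ℕ, shortCharSum p M N
      = shortCharSum p (M + h) N + (shortCharSum p M h - shortCharSum p (M + N) h) := by
    intro h
    have h1 := shortCharSum_add M N h
    have h2 := shortCharSum_add M h N
    rw [add_comm h N] at h2
    linarith
  have hsum : (A * B) * shortCharSum p M N
      = ∑ a ∈ Finset.Icc 1 A, ∑ b ∈ Finset.range B, shortCharSum p (M + (a * b : ℕ)) N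
      + ∑ a ∈ Finset.Icc 1 A, ∑ b ∈ Finset.range B,
        (shortCharSum p M (a * b) - shortCharSum p (M + N) (a * b)) := by
    simp only [← Finset.sum_add_distrib, ← hshift]
    simp
    ring
  have herr : |∑ a ∈ Finset.Icc 1 A, ∑ b ∈ Finset.range B,
        (shortCharSum p M (a * b) - shortCharSum p (M + N) (a * b))| ≤ (A * B) * (2 * E) := by
    refine (Finset.abs_sum_le_sum_abs _ _).trans ?_
    have h1 : ∀ a ∈ Finset.Icc 1 A, |∑ b ∈ Finset.range B,
        (shortCharSum p M (a * b) - shortCharSum p (M + N) (a * b))| ≤ B * (2 * E) := by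
      intro a ha
      refine (Finset.abs_sum_le_sum_abs _ _).trans ?_
      have h2 : ∀ b ∈ Finset.range B,
          |shortCharSum p M (a * b) - shortCharSum p (M + N) (a * b)| ≤ 2 * E := by
        intro b hb
        have hab : a * b ≤ A * B :=
          Nat.mul_le_mul (Finset.mem_Icc.mp ha).2 (Finset.mem_range.mp hb).le
        have h3 := hE M _ hab
        have h4 := hE (M + N) _ hab
        have h5 := abs_sub (shortCharSum p M (a * b)) (shortCharSum p (M + N) (a * b))
        linarith
      refine (Finset.sum_le_sum h2).trans (le_of_eq ?_)
      simp
    refine (Finset.sum_le_sum h1).trans (le_of_eq ?_)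
    simp
    ring
  have hmain : |∑ a ∈ Finset.Icc 1 A, ∑ b ∈ Finset.range B, shortCharSum p (M + (a * b : ℕ)) N|
      ≤ shiftedMean p M A B N := by
    rw [shiftedMean, Finset.sum_product]
    refine (Finset.abs_sum_le_sum_abs _ _).trans (Finset.sum_le_sum fun a ha => ?_)
    simp only [shortCharSum]
    rw [Finset.sum_comm]
    refine (Finset.abs_sum_le_sum_abs _ _).trans (Finset.sum_le_sum fun i _ => ?_)
    have ha0 : (a : ZMod p) ≠ 0 := by
      rw [Finset.mem_Icc] at ha
      rw [Ne, ZMod.natCast_eq_zero_iff]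
      exact Nat.not_dvd_of_pos_of_lt ha.1 (by omega)
    have h1 : ∀ b ∈ Finset.range B, realQuadraticChar p (M + ((a * b : ℕ) : ZMod p) + (i : ℕ))
        = realQuadraticChar p a * realQuadraticChar p ((M + (i : ℕ)) / (a : ℕ) + b) := by
      intro b _
      rw [← realQuadraticChar_mul]
      congr 1
      push_cast
      field_simp
      ring
    rw [Finset.sum_congr rfl h1, ← Finset.mul_sum, abs_mul]
    exact mul_le_of_le_one_left (abs_nonneg _) (abs_realQuadraticChar_le_one _)
  have habs : (A * B : ℝ) * |shortCharSum p M N| = |(A * B) * shortCharSum p M N| := by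
    rw [abs_mul, abs_of_nonneg (a := (A * B : ℝ)) (by positivity)]
  rw [habs, hsum]
  exact (abs_add_le _ _).trans (add_le_add hmain herr)

lemma shiftedMean_pow_le (hp2 : p ≠ 2) (M : ZMod p) {A B N r : ℕ} (hA : 1 ≤ A)
    (hAN : 2 * A * N ≤ p) (hle : A ≤ N) (hB : B ≤ p) (hr : 1 ≤ r) :
    shiftedMean p M A B N ^ (2 * r) ≤
      ((A * N : ℝ) ^ (r - 1)) ^ 2 *
        ((2 * A * N * (∑ d ∈ Finset.Icc 1 A, (1 : ℝ) / d) ^ 2) *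
        (r ^ (2 * r) * B ^ r * p + (62 * r + 64) * B ^ (2 * r) * √p)) := by
  set P := Finset.Icc 1 A ×ˢ Finset.range N with hP
  set φ : ℕ × ℕ → ZMod p := fun u => (M + (u.2 : ℕ)) / (u.1 : ℕ) with hφ
  set G : ZMod p → ℝ := fun x => |∑ b ∈ Finset.range B, realQuadraticChar p (x + b)| with hG
  have hG0 : ∀ x, 0 ≤ G x := fun x => abs_nonneg _
  have hPcard : (P.card : ℝ) = A * N := by simp [hP]
  have hT : shiftedMean p M A B N = ∑ u ∈ P, G (φ u) := rfl
  obtain ⟨n, rfl⟩ : ∃ n, r = n + 1 := ⟨r - 1, by omega⟩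
  have h1 : (∑ u ∈ P, G (φ u)) ^ (n + 1) ≤ (A * N : ℝ) ^ n * ∑ u ∈ P, G (φ u) ^ (n + 1) := by
    have h := pow_sum_div_card_le_sum_pow (s := P) (f := fun u => G (φ u)) (fun u _ => hG0 _) n
    rw [hPcard] at h
    have hpos : (0 : ℝ) < (A * N : ℝ) ^ n := by
      have hA' : (0 : ℝ) < A := by exact_mod_cast hA
      have hN' : (0 : ℝ) < N := by exact_mod_cast hA.trans hle
      positivity
    rw [div_le_iff₀ hpos] at h
    linarith
  have h2 : ∑ u ∈ P, G (φ u) ^ (n + 1)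
      = ∑ x : ZMod p, ((P.filter fun u => φ u = x).card : ℝ) * G x ^ (n + 1) := by
    rw [← Finset.sum_fiberwise' P φ fun x => G x ^ (n + 1)]
    simp
  have h3 : (∑ x : ZMod p, ((P.filter fun u => φ u = x).card : ℝ) * G x ^ (n + 1)) ^ 2
      ≤ (∑ x : ZMod p, ((P.filter fun u => φ u = x).card : ℝ) ^ 2) *
        ∑ x : ZMod p, (G x ^ (n + 1)) ^ 2 := Finset.sum_mul_sq_le_sq_mul_sq _ _ _
  have h4 : ∑ x : ZMod p, (G x ^ (n + 1)) ^ 2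
      = ∑ x : ZMod p, (∑ b ∈ Finset.range B, realQuadraticChar p (x + b)) ^ (2 * (n + 1)) := by
    refine Finset.sum_congr rfl fun x _ => ?_
    rw [← pow_mul, mul_comm (n + 1) 2, pow_mul, pow_mul, hG, sq_abs]
  have h5 := sum_sq_card_fiber_quotient_le M hA hAN hle
  have h6 := sum_pow_shifted_sum_realQuadraticChar_le hp2 hB (n + 1)
  have h0 : 0 ≤ ∑ u ∈ P, G (φ u) := Finset.sum_nonneg fun u _ => hG0 _
  rw [hT, mul_comm 2 (n + 1), pow_mul, Nat.add_sub_cancel]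
  calc ((∑ u ∈ P, G (φ u)) ^ (n + 1)) ^ 2
      ≤ ((A * N : ℝ) ^ n * ∑ u ∈ P, G (φ u) ^ (n + 1)) ^ 2 := by gcongr
    _ = ((A * N : ℝ) ^ n) ^ 2 *
        (∑ x : ZMod p, ((P.filter fun u => φ u = x).card : ℝ) * G x ^ (n + 1)) ^ 2 := by
        rw [h2, mul_pow]
    _ ≤ _ := by
        refine mul_le_mul_of_nonneg_left (h3.trans ?_) (by positivity)
        rw [h4]
        rw [mul_comm (n + 1) 2]
        exact mul_le_mul h5 h6
          (Finset.sum_nonneg fun x _ => by rw [pow_mul]; positivity) (by positivity)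

end Burgess

section Burgess

lemma moment_bound_le {a b n y H : ℝ} {s : ℕ} (ha : 1 ≤ a) (hb : 1 ≤ b)
    (hby : b ≤ y) (hyb : y ≤ 2 * b) (hnab : n ≤ 128 * (a * b)) {R₁ R₂ : ℝ} (hR₁ : 0 ≤ R₁)
    (hR₂ : 0 ≤ R₂) :
    ((a * n) ^ s) ^ 2 * ((2 * a * n * H ^ 2) *
      (R₁ * b ^ (s + 1) * y ^ (2 * (s + 1)) + R₂ * b ^ (2 * (s + 1)) * y ^ (s + 1))) ≤
    256 * 2 ^ (2 * s + 1) * (R₁ + R₂) * H ^ 2 * ((a * b) ^ (2 * (s + 1)) *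
      (n ^ (2 * s) * y ^ (s + 2))) := by
  have ha0 : 0 ≤ a := by linarith
  have hb0 : 0 ≤ b := by linarith
  have hy0 : 0 ≤ y := hb0.trans hby
  have h1 : R₁ * b ^ (s + 1) * y ^ (2 * (s + 1)) + R₂ * b ^ (2 * (s + 1)) * y ^ (s + 1)
      ≤ (R₁ + R₂) * ((2 * b) ^ (2 * s + 1) * y ^ (s + 2)) := by
    calc _ ≤ R₁ * y ^ (s + 1) * y ^ (2 * (s + 1)) + R₂ * y ^ (2 * (s + 1)) * y ^ (s + 1) := by
          gcongr
      _ = (R₁ + R₂) * (y ^ (2 * s + 1) * y ^ (s + 2)) := by ring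
      _ ≤ _ := by gcongr
  calc _ ≤ ((a * n) ^ s) ^ 2 * ((2 * a * (128 * (a * b)) * H ^ 2) *
      ((R₁ + R₂) * ((2 * b) ^ (2 * s + 1) * y ^ (s + 2)))) := by gcongr
    _ = _ := by
      rw [mul_pow 2 b]
      ring

lemma sum_Icc_one_div_le {κ : ℝ} (hκ : 0 < κ) {A : ℕ} {x : ℝ} (hA : 1 ≤ A) (hAx : (A : ℝ) ≤ x) :
    ∑ d ∈ Finset.Icc 1 A, (1 : ℝ) / d ≤ (1 + 1 / κ) * x ^ κ := by
  have h := harmonic_le_one_add_log A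
  rw [harmonic_eq_sum_Icc] at h
  push_cast at h
  have hA' : (1 : ℝ) ≤ A := by exact_mod_cast hA
  have hx : (1 : ℝ) ≤ x := by linarith
  have h1 : Real.log A ≤ x ^ κ / κ :=
    (Real.log_le_log (by linarith) hAx).trans (Real.log_le_rpow_div (by linarith) hκ)
  have h2 : (1 : ℝ) ≤ x ^ κ := Real.one_le_rpow hx hκ.le
  simp only [one_div]
  calc _ ≤ 1 + Real.log A := h
    _ ≤ x ^ κ + x ^ κ / κ := by linarith
    _ = _ := by ring

variable {p : ℕ} [Fact p.Prime]

lemma shiftedMean_le (hp2 : p ≠ 2) (M : ZMod p) {A B N s : ℕ} {y κ : ℝ} (hκ : 0 < κ)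
    (hA : 1 ≤ A) (hAN : 2 * A * N ≤ p) (hle : A ≤ N) (hB1 : 1 ≤ B) (hB : B ≤ p)
    (hy : y = (p : ℝ) ^ (1 / (2 * (s + 1)) : ℝ)) (hby : (B : ℝ) ≤ y) (hyb : y ≤ 2 * B)
    (hnab : N ≤ 128 * (A * B)) :
    shiftedMean p M A B N ≤
      max 1 (256 * 2 ^ (2 * s + 1) * ((s + 1) ^ (2 * (s + 1)) + (62 * (s + 1) + 64)) *
        (1 + 1 / κ) ^ 2) * ((A * B) * ((N : ℝ) ^ (1 - 1 / (s + 1) : ℝ) *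
          (p : ℝ) ^ ((s + 2) / (4 * (s + 1) ^ 2) + κ : ℝ))) := by
  have hp0 : (0 : ℝ) < p := by exact_mod_cast (Fact.out : p.Prime).pos
  have hp1 : (1 : ℝ) ≤ p := by exact_mod_cast (Fact.out : p.Prime).one_le
  have hs : (0 : ℝ) < (s : ℝ) + 1 := by positivity
  have hy0 : 0 ≤ y := by rw [hy]; positivity
  have hyp : y ^ (2 * (s + 1)) = p := by
    rw [hy, ← Real.rpow_natCast, ← Real.rpow_mul hp0.le]
    push_cast
    rw [one_div_mul_cancel (by positivity), Real.rpow_one]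
  have hysq : y ^ (s + 1) = √(p : ℝ) := by
    rw [← hyp, mul_comm, pow_mul, Real.sqrt_sq (by positivity)]
  set H := ∑ d ∈ Finset.Icc 1 A, (1 : ℝ) / d with hH
  have hA' : (1 : ℝ) ≤ A := by exact_mod_cast hA
  have hAp : A ≤ p := by nlinarith
  have hH0 : 0 ≤ H := Finset.sum_nonneg fun i _ => by positivity
  have hHle : H ≤ (1 + 1 / κ) * (p : ℝ) ^ κ :=
    sum_Icc_one_div_le hκ hA (by exact_mod_cast hAp)
  have h1 := shiftedMean_pow_le hp2 M hA hAN hle hB (r := s + 1) (by omega)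
  rw [← hH, Nat.add_sub_cancel, ← hysq] at h1
  rw [← hyp] at h1
  have h2 := h1.trans (moment_bound_le (H := H) (s := s) hA' (by exact_mod_cast hB1)
    hby hyb (by exact_mod_cast hnab) (by positivity) (by positivity))
  set K₁ : ℝ := 256 * 2 ^ (2 * s + 1) * ((s + 1) ^ (2 * (s + 1)) + (62 * (s + 1) + 64)) *
        (1 + 1 / κ) ^ 2 with hK₁
  have hQ : ((N : ℝ) ^ (1 - 1 / (s + 1) : ℝ) *
          (p : ℝ) ^ ((s + 2) / (4 * (s + 1) ^ 2) + κ : ℝ)) ^ (2 * (s + 1))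
        = N ^ (2 * s) * y ^ (s + 2) * ((p : ℝ) ^ κ) ^ (2 * (s + 1)) := by
    rw [Real.rpow_add hp0, mul_pow, mul_pow, mul_assoc]
    congr 1
    · rw [← Real.rpow_natCast, ← Real.rpow_natCast, ← Real.rpow_mul (Nat.cast_nonneg N)]
      congr 1
      push_cast
      field_simp
      ring
    · congr 1
      rw [hy, ← Real.rpow_mul_natCast hp0.le, ← Real.rpow_mul_natCast hp0.le]
      congr 1
      push_cast
      field_simp
      norm_num
  set Q := (N : ℝ) ^ (1 - 1 / (s + 1) : ℝ) *
          (p : ℝ) ^ ((s + 2) / (4 * (s + 1) ^ 2) + κ : ℝ) with hQdef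
  have hQ0 : 0 ≤ Q := by positivity
  have hpk : 1 ≤ (p : ℝ) ^ κ := Real.one_le_rpow hp1 hκ.le
  have h3 : shiftedMean p M A B N ^ (2 * (s + 1)) ≤ (max 1 K₁ * ((A * B) * Q)) ^ (2 * (s + 1)) := by
    have h4 : H ^ 2 ≤ (1 + 1 / κ) ^ 2 * ((p : ℝ) ^ κ) ^ (2 * (s + 1)) := by
      calc H ^ 2 ≤ ((1 + 1 / κ) * (p : ℝ) ^ κ) ^ 2 := by gcongr
        _ = (1 + 1 / κ) ^ 2 * ((p : ℝ) ^ κ) ^ 2 := by ring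
        _ ≤ _ := by
          gcongr
          · omega
    have h5 : K₁ ≤ max 1 K₁ ^ (2 * (s + 1)) :=
      (le_max_right 1 K₁).trans (le_self_pow₀ (le_max_left _ _) (by omega))
    calc _ ≤ _ := h2
      _ ≤ 256 * 2 ^ (2 * s + 1) * ((((s + 1 : ℕ) : ℝ)) ^ (2 * (s + 1)) +
          (62 * ((s + 1 : ℕ) : ℝ) + 64)) *
          ((1 + 1 / κ) ^ 2 * ((p : ℝ) ^ κ) ^ (2 * (s + 1))) *
          ((A * B : ℝ) ^ (2 * (s + 1)) * (N ^ (2 * s) * y ^ (s + 2))) := by gcongr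
      _ = K₁ * ((A * B : ℝ) ^ (2 * (s + 1)) *
          (N ^ (2 * s) * y ^ (s + 2) * ((p : ℝ) ^ κ) ^ (2 * (s + 1)))) := by
        rw [hK₁]
        push_cast
        ring
      _ = K₁ * ((A * B : ℝ) * Q) ^ (2 * (s + 1)) := by rw [← hQ, mul_pow (A * B : ℝ)]
      _ ≤ max 1 K₁ ^ (2 * (s + 1)) * ((A * B : ℝ) * Q) ^ (2 * (s + 1)) := by gcongr
      _ = _ := by rw [mul_pow (max 1 K₁)]
  exact le_of_pow_le_pow_left₀ (by omega) (by positivity) h3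

/-- Burgess's bound for short sums of the quadratic character modulo `p`, of length at most `√p`. -/
theorem abs_shortCharSum_le_burgess_of_sq_le (s : ℕ) (hs : 1 ≤ s) {κ : ℝ} (hκ : 0 < κ) :
    ∃ K : ℝ, 0 < K ∧ ∀ (p : ℕ) [Fact p.Prime], p ≠ 2 → ∀ N : ℕ, N * N ≤ p → ∀ M : ZMod p,
      |shortCharSum p M N| ≤ K * ((N : ℝ) ^ (1 - 1 / (s + 1) : ℝ) *
          (p : ℝ) ^ ((s + 2) / (4 * (s + 1) ^ 2) + κ : ℝ)) := by
  set K₀ : ℝ := max 1 (256 * 2 ^ (2 * s + 1) * ((s + 1) ^ (2 * (s + 1)) + (62 * (s + 1) + 64)) *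
        (1 + 1 / κ) ^ 2) with hK₀
  have hK₀1 : 1 ≤ K₀ := le_max_left _ _
  set K := max 64 (2 * K₀) with hK
  have hK64 : 64 ≤ K := le_max_left _ _
  have hK2 : 2 * K₀ ≤ K := le_max_right _ _
  have hs' : (1 : ℝ) ≤ s := by exact_mod_cast hs
  have hθ : 1 / ((s : ℝ) + 1) ≤ 1 / 2 := one_div_le_one_div_of_le (by norm_num) (by linarith)
  have hθ0 : 0 < 1 / ((s : ℝ) + 1) := by positivity
  refine ⟨K, by linarith, fun p _ hp2 N => ?_⟩
  have hp0 : (0 : ℝ) < p := by exact_mod_cast (Fact.out : p.Prime).pos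
  have hp1 : (1 : ℝ) ≤ p := by exact_mod_cast (Fact.out : p.Prime).one_le
  set y : ℝ := (p : ℝ) ^ (1 / (2 * (s + 1)) : ℝ) with hy
  have hy1 : 1 ≤ y := Real.one_le_rpow hp1 (by positivity)
  have hyp : y ≤ p := by
    rw [hy]
    apply Real.rpow_le_self_of_one_le hp1
    rw [div_le_one (by positivity)]
    linarith
  set B := ⌊y⌋₊ with hB
  have hB1 : 1 ≤ B := Nat.one_le_floor_iff _ |>.mpr hy1
  have hBy : (B : ℝ) ≤ y := Nat.floor_le (by linarith)
  have hyB : y ≤ 2 * B := by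
    have h1 := Nat.lt_floor_add_one y
    have h2 : (1 : ℝ) ≤ B := by exact_mod_cast hB1
    linarith
  have hBp : B ≤ p := by exact_mod_cast hBy.trans hyp
  set P : ℝ := (p : ℝ) ^ ((s + 2) / (4 * (s + 1) ^ 2) + κ : ℝ) with hP
  have hP0 : 0 ≤ P := by positivity
  induction N using Nat.strong_induction_on with
  | _ N ih =>
  intro hN M
  rcases Nat.eq_zero_or_pos (N / (64 * B)) with hA | hA
  · rw [Nat.div_eq_zero_iff_lt (by positivity)] at hA
    refine (abs_shortCharSum_le M N).trans ?_
    rcases Nat.eq_zero_or_pos N with rfl | hNpos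
    · simp only [Nat.cast_zero]; positivity
    have hN0 : (0 : ℝ) < N := by exact_mod_cast hNpos
    have h1 : (N : ℝ) ^ (1 / (s + 1) : ℝ) ≤ 64 * P := by
      calc (N : ℝ) ^ (1 / (s + 1) : ℝ) ≤ (64 * y) ^ (1 / (s + 1) : ℝ) := by
            gcongr
            have : (N : ℝ) < 64 * B := by exact_mod_cast hA
            linarith
        _ = 64 ^ (1 / (s + 1) : ℝ) * y ^ (1 / (s + 1) : ℝ) :=
            Real.mul_rpow (by norm_num) (by linarith)
        _ ≤ 64 * P := by
            gcongr
            · apply Real.rpow_le_self_of_one_le (by norm_num)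
              linarith
            · rw [hy, hP, ← Real.rpow_mul hp0.le]
              apply Real.rpow_le_rpow_of_exponent_le hp1
              have : 1 / (2 * ((s : ℝ) + 1)) * (1 / (s + 1)) ≤ (s + 2) / (4 * (s + 1) ^ 2) := by
                rw [one_div_mul_one_div, div_le_div_iff₀ (by positivity) (by positivity)]
                nlinarith [sq_nonneg ((s : ℝ) + 1)]
              linarith
    calc (N : ℝ) = (N : ℝ) ^ (1 - 1 / (s + 1) : ℝ) * (N : ℝ) ^ (1 / (s + 1) : ℝ) := by
          rw [← Real.rpow_add hN0, sub_add_cancel, Real.rpow_one]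
      _ ≤ (N : ℝ) ^ (1 - 1 / (s + 1) : ℝ) * (64 * P) := by gcongr
      _ = 64 * ((N : ℝ) ^ (1 - 1 / (s + 1) : ℝ) * P) := by ring
      _ ≤ _ := by gcongr
  · set A := N / (64 * B) with hAdef
    have hAB : 64 * (A * B) ≤ N := by
      have := Nat.div_mul_le_self N (64 * B)
      rw [← hAdef] at this
      linarith
    have hNA : N ≤ 128 * (A * B) := by
      have h1 := Nat.lt_mul_div_succ N (show 0 < 64 * B by positivity)
      rw [← hAdef] at h1
      nlinarith
    have hA64 : 64 * A ≤ N := by nlinarith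
    have hABpos : 1 ≤ A * B := Nat.mul_pos hA hB1
    have hNpos : 64 ≤ N := by omega
    have hAN : 2 * A * N ≤ p := by nlinarith
    have hNN : N ≤ N * N := by nlinarith
    have hAp : A < p := by omega
    have hAB64 : ((A * B : ℕ) : ℝ) ≤ N / 64 := by
      rw [le_div_iff₀ (by norm_num)]
      exact_mod_cast (by linarith : A * B * 64 ≤ N)
    have hE : ∀ M' : ZMod p, ∀ h ≤ A * B, |shortCharSum p M' h| ≤
        K / 8 * ((N : ℝ) ^ (1 - 1 / (s + 1) : ℝ) * P) := by
      intro M' h hh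
      have h1 := ih h (by omega) (by nlinarith) M'
      have h2 : (h : ℝ) ≤ N / 64 := le_trans (by exact_mod_cast hh) hAB64
      have h3 : (8 : ℝ) ≤ 64 ^ (1 - 1 / (s + 1) : ℝ) := by
        calc (8 : ℝ) = 64 ^ (1 / 2 : ℝ) := by
              rw [show (64 : ℝ) = 8 ^ (2 : ℝ) by norm_num, ← Real.rpow_mul (by norm_num)]
              norm_num
          _ ≤ _ := Real.rpow_le_rpow_of_exponent_le (by norm_num) (by linarith)
      calc _ ≤ _ := h1
        _ ≤ K * ((N / 64 : ℝ) ^ (1 - 1 / (s + 1) : ℝ) * P) := by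
            gcongr
            linarith
        _ = K * ((N : ℝ) ^ (1 - 1 / (s + 1) : ℝ) / 64 ^ (1 - 1 / (s + 1) : ℝ) * P) := by
            rw [Real.div_rpow (Nat.cast_nonneg N) (by norm_num)]
        _ ≤ K * ((N : ℝ) ^ (1 - 1 / (s + 1) : ℝ) / 8 * P) := by gcongr
        _ = _ := by ring
    have h1 := mul_abs_shortCharSum_le (N := N) M hAp hE
    have h2 := shiftedMean_le hp2 M hκ hA hAN (by omega) hB1 hBp hy hBy hyB hNA
    rw [← hK₀, ← hP] at h2
    have hABpos' : (0 : ℝ) < (A * B : ℝ) := by exact_mod_cast hABpos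
    set Q := (N : ℝ) ^ (1 - 1 / (s + 1) : ℝ) * P with hQ
    have hQ0 : 0 ≤ Q := by positivity
    refine le_of_mul_le_mul_left (h1.trans ?_) hABpos'
    have h3 : K₀ * Q + 2 * (K / 8 * Q) ≤ K * Q := by nlinarith
    nlinarith

end Burgess

section Burgess

lemma abs_shortCharSum_mul_le {p : ℕ} [Fact p.Prime] {L : ℕ} {E : ℝ}
    (hE : ∀ M : ZMod p, |shortCharSum p M L| ≤ E) (q : ℕ) (M : ZMod p) :
    |shortCharSum p M (L * q)| ≤ q * E := by
  induction q with
  | zero => simp [shortCharSum]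
  | succ q ih =>
    rw [mul_add_one, shortCharSum_add]
    refine (abs_add_le _ _).trans ?_
    have h := hE (M + ((L * q : ℕ) : ZMod p))
    rw [Nat.cast_add_one, add_one_mul]
    linarith

lemma shortCharSum_period {p : ℕ} [Fact p.Prime] (hp2 : p ≠ 2) (M : ZMod p) :
    shortCharSum p M p = 0 := by
  have h : ∑ a : ZMod p, quadraticChar (ZMod p) a = 0 :=
    quadraticChar_sum_zero (by rwa [ZMod.ringChar_zmod_n])
  have h1 : ∑ a : ZMod p, realQuadraticChar p (M + a) = 0 := by
    rw [show ∑ a : ZMod p, realQuadraticChar p (M + a) = ∑ a : ZMod p, realQuadraticChar p a from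
      Equiv.sum_comp (Equiv.addLeft M) (realQuadraticChar p)]
    simp only [realQuadraticChar]
    exact_mod_cast h
  rw [shortCharSum, ← h1]
  refine Finset.sum_bij' (fun i _ => (i : ZMod p)) (fun a _ => a.val) ?_ ?_ ?_ ?_ ?_
  · simp
  · intro a _
    simpa using ZMod.val_lt a
  · intro i hi
    exact ZMod.val_cast_of_lt (Finset.mem_range.mp hi)
  · intro a _
    simp
  · intro i hi
    rfl

lemma abs_shortCharSum_le_prime {p : ℕ} [Fact p.Prime] (hp2 : p ≠ 2) (M : ZMod p) (N : ℕ) :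
    |shortCharSum p M N| ≤ p := by
  have hp : 0 < p := (Fact.out : p.Prime).pos
  have h1 := abs_shortCharSum_mul_le (fun M' => (abs_eq_zero.mpr (shortCharSum_period hp2 M')).le)
    (N / p) M
  have h2 := shortCharSum_add M (p * (N / p)) (N % p)
  rw [Nat.div_add_mod] at h2
  rw [mul_zero] at h1
  have h3 := abs_shortCharSum_le (M + ((p * (N / p) : ℕ) : ZMod p)) (N % p)
  have h4 : ((N % p : ℕ) : ℝ) ≤ p := by exact_mod_cast (Nat.mod_lt N hp).le
  rw [h2]
  exact (abs_add_le _ _).trans (by linarith)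

/-- Burgess's bound for sums of the quadratic character modulo `p` over arbitrary intervals. -/
theorem abs_shortCharSum_le_burgess (s : ℕ) (hs : 1 ≤ s) {κ : ℝ} (hκ : 0 < κ) :
    ∃ K : ℝ, 0 < K ∧ ∀ (p : ℕ) [Fact p.Prime], p ≠ 2 → ∀ (M : ZMod p) (N : ℕ),
      |shortCharSum p M N| ≤ K * ((N : ℝ) ^ (1 - 1 / (s + 1) : ℝ) *
          (p : ℝ) ^ ((s + 2) / (4 * (s + 1) ^ 2) + κ : ℝ) +
          N * (p : ℝ) ^ (-(s / (4 * (s + 1) ^ 2)) + κ : ℝ)) := by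
  obtain ⟨K, hK, hmain⟩ := abs_shortCharSum_le_burgess_of_sq_le s hs hκ
  have hθ0 : 0 < 1 / ((s : ℝ) + 1) := by positivity
  have hθ1 : 1 / ((s : ℝ) + 1) ≤ 1 := by
    rw [div_le_one (by positivity)]
    linarith [Nat.cast_nonneg (α := ℝ) s]
  refine ⟨2 * K, by positivity, fun p _ hp2 M N => ?_⟩
  have hp0 : (0 : ℝ) < p := by exact_mod_cast (Fact.out : p.Prime).pos
  have hp1 : 1 ≤ p := (Fact.out : p.Prime).one_le
  set P : ℝ := (p : ℝ) ^ ((s + 2) / (4 * (s + 1) ^ 2) + κ : ℝ) with hP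
  have hP0 : 0 ≤ P := by positivity
  set L := Nat.sqrt p with hL
  have hL1 : 1 ≤ L := Nat.sqrt_pos.mpr hp1
  have hL0 : (0 : ℝ) < L := by exact_mod_cast hL1
  have hLp : √(p : ℝ) ≤ 2 * L := by
    rw [Real.sqrt_le_left (by positivity)]
    have h1 : p < (L + 1) * (L + 1) := Nat.lt_succ_sqrt p
    have h2 : p ≤ (2 * L) ^ 2 := by nlinarith
    exact_mod_cast h2
  have hLθ : (L : ℝ) ^ (-(1 / (s + 1)) : ℝ) ≤ 2 * (p : ℝ) ^ (-(1 / (2 * (s + 1))) : ℝ) := by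
    rw [Real.rpow_neg hL0.le, Real.rpow_neg hp0.le, ← div_eq_mul_inv,
      inv_le_comm₀ (by positivity) (by positivity), inv_div]
    calc (p : ℝ) ^ (1 / (2 * (s + 1)) : ℝ) / 2 = √(p : ℝ) ^ (1 / (s + 1) : ℝ) / 2 := by
          rw [Real.sqrt_eq_rpow, ← Real.rpow_mul hp0.le, one_div_mul_one_div]
      _ ≤ (2 * L : ℝ) ^ (1 / (s + 1) : ℝ) / 2 := by gcongr
      _ = 2 ^ (1 / (s + 1) : ℝ) * (L : ℝ) ^ (1 / (s + 1) : ℝ) / 2 := by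
          rw [Real.mul_rpow (by norm_num) hL0.le]
      _ ≤ 2 * (L : ℝ) ^ (1 / (s + 1) : ℝ) / 2 := by
          gcongr
          exact Real.rpow_le_self_of_one_le (by norm_num) hθ1
      _ = _ := by ring
  have h1 := abs_shortCharSum_mul_le (hmain p hp2 L (Nat.sqrt_le p)) (N / L) M
  have h2 := shortCharSum_add M (L * (N / L)) (N % L)
  rw [Nat.div_add_mod] at h2
  have hmod : N % L ≤ L := (Nat.mod_lt N hL1).le
  have h3 := hmain p hp2 (N % L) ((Nat.mul_le_mul hmod hmod).trans (Nat.sqrt_le p))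
    (M + (L * (N / L) : ℕ))
  have h4 : ((N / L : ℕ) : ℝ) * (K * ((L : ℝ) ^ (1 - 1 / (s + 1) : ℝ) * P)) ≤
      2 * K * (N * (p : ℝ) ^ (-(s / (4 * (s + 1) ^ 2)) + κ : ℝ)) := by
    have h5 : ((N / L : ℕ) : ℝ) * L ≤ N := by exact_mod_cast Nat.div_mul_le_self N L
    calc _ = K * (((N / L : ℕ) : ℝ) * L) * ((L : ℝ) ^ (-(1 / (s + 1)) : ℝ) * P) := by
          rw [sub_eq_add_neg, Real.rpow_add hL0, Real.rpow_one]
          ring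
      _ ≤ K * N * ((2 * (p : ℝ) ^ (-(1 / (2 * (s + 1))) : ℝ)) * P) := by gcongr
      _ = 2 * K * (N * ((p : ℝ) ^ (-(1 / (2 * (s + 1))) : ℝ) * P)) := by ring
      _ = _ := by
          rw [hP, ← Real.rpow_add hp0]
          have h8 : -(1 / (2 * ((s : ℝ) + 1))) + ((s + 2) / (4 * (s + 1) ^ 2) + κ)
              = -(s / (4 * (s + 1) ^ 2)) + κ := by
            field_simp
            ring
          rw [h8]
  have h6 : K * (((N % L : ℕ) : ℝ) ^ (1 - 1 / (s + 1) : ℝ) * P) ≤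
      2 * K * ((N : ℝ) ^ (1 - 1 / (s + 1) : ℝ) * P) := by
    have h7 : ((N % L : ℕ) : ℝ) ^ (1 - 1 / (s + 1) : ℝ) ≤ (N : ℝ) ^ (1 - 1 / (s + 1) : ℝ) := by
      apply Real.rpow_le_rpow (by positivity) _ (by linarith)
      exact_mod_cast Nat.mod_le N L
    gcongr
    linarith
  rw [h2]
  refine (abs_add_le _ _).trans ?_
  rw [mul_add]
  linarith

end Burgess

section Sieve

lemma sum_divisors_moebius (n : ℕ) :
    ∑ d ∈ n.divisors, ArithmeticFunction.moebius d = if n = 1 then 1 else 0 := by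
  rw [← ArithmeticFunction.coe_mul_zeta_apply, ArithmeticFunction.moebius_mul_coe_zeta,
    ArithmeticFunction.one_apply]

lemma sq_dvd_sq_mul_iff {a b d : ℕ} (ha : Squarefree a) (hb : b ≠ 0) :
    d ^ 2 ∣ b ^ 2 * a ↔ d ∣ b := by
  refine ⟨fun h => ?_, fun h => (pow_dvd_pow_of_dvd h 2).mul_right a⟩
  have ha0 : a ≠ 0 := ha.ne_zero
  have hd0 : d ≠ 0 := by
    rintro rfl
    have : b ^ 2 * a = 0 := by simpa using h
    simp_all
  rw [← Nat.factorization_le_iff_dvd hd0 hb]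
  intro q
  have h1 := (Nat.factorization_le_iff_dvd (by positivity) (by positivity)).mpr h q
  have h2 := ha.natFactorization_le_one q
  rw [Nat.factorization_mul (by positivity) ha0] at h1
  simp only [Nat.factorization_pow, Finsupp.coe_add, Finsupp.coe_smul, Pi.add_apply,
    Pi.smul_apply, smul_eq_mul] at h1
  omega

lemma sum_moebius_sq_dvd {n R : ℕ} (hn : n ≠ 0) (hR : n ≤ R) :
    ∑ d ∈ Finset.Icc 1 R, (if d ^ 2 ∣ n then ArithmeticFunction.moebius d else 0)
      = if Squarefree n then 1 else 0 := by
  obtain ⟨a, b, ha0, hb0, rfl, ha⟩ := Nat.sq_mul_squarefree_of_pos (Nat.pos_of_ne_zero hn)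
  have h1 : (Finset.Icc 1 R).filter (fun d => d ^ 2 ∣ b ^ 2 * a) = b.divisors := by
    ext d
    rw [Finset.mem_filter, Finset.mem_Icc, Nat.mem_divisors, sq_dvd_sq_mul_iff ha hb0.ne']
    refine ⟨fun h => ⟨h.2, hb0.ne'⟩, fun h => ⟨⟨Nat.pos_of_dvd_of_pos h.1 hb0, ?_⟩, h.1⟩⟩
    have := Nat.le_of_dvd hb0 h.1
    nlinarith
  rw [← Finset.sum_filter, h1, sum_divisors_moebius]
  congr 1
  rw [eq_iff_iff]
  refine ⟨?_, fun h => ?_⟩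
  · rintro rfl
    simpa using ha
  · have := h b ⟨a, by ring⟩
    simpa using this

lemma sum_moebius_dvd_coprime {D n : ℕ} (hD : D ≠ 0) :
    ∑ δ ∈ D.divisors, (if δ ∣ n then ArithmeticFunction.moebius δ else 0)
      = if n.Coprime D then 1 else 0 := by
  have h1 : D.divisors.filter (fun δ => δ ∣ n) = (n.gcd D).divisors := by
    ext d
    simp [Nat.dvd_gcd_iff, hD, and_comm]
  rw [← Finset.sum_filter, h1, sum_divisors_moebius]

variable {p : ℕ} [Fact p.Prime]

lemma sum_Ico_realQuadraticChar (u v : ℤ) (M : ZMod p) :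
    ∑ k ∈ Finset.Ico u v, realQuadraticChar p (M + k) =
      shortCharSum p (M + u) (v - u).toNat := by
  rw [shortCharSum]
  refine Finset.sum_bij' (fun k _ => (k - u).toNat) (fun i _ => u + i) ?_ ?_ ?_ ?_ ?_
  · intro k hk
    rw [Finset.mem_Ico] at hk
    rw [Finset.mem_range]
    omega
  · intro i hi
    rw [Finset.mem_range] at hi
    rw [Finset.mem_Ico]
    omega
  · intro k hk
    rw [Finset.mem_Ico] at hk
    omega
  · intro i hi
    omega
  · intro k hk
    rw [Finset.mem_Ico] at hk
    have h1 : ((k - u).toNat : ℤ) = k - u := Int.toNat_of_nonneg (by omega)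
    have h2 : (((k - u).toNat : ℕ) : ZMod p) = ((k - u : ℤ) : ZMod p) := by
      rw [← Int.cast_natCast, h1]
    rw [h2]
    push_cast
    congr 1
    ring

lemma abs_sum_modEq_realQuadraticChar_le {a b c Q : ℤ} (hQ : 0 < Q) (hpQ : (Q : ZMod p) ≠ 0) :
    ∃ (M : ZMod p) (N : ℕ), (N : ℝ) ≤ max 0 ((b - a : ℝ) / (Q : ℝ) + 1) ∧
      |∑ m ∈ (Finset.Ico a b).filter (fun m => m ≡ c [ZMOD Q]), realQuadraticChar p (m : ZMod p)|
        ≤ |shortCharSum p M N| := by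
  rw [Int.Ico_filter_modEq_eq, Int.Ico_filter_dvd_eq _ _ hQ, Finset.sum_map, Finset.sum_map]
  set u := ⌈((a - c : ℤ) : ℚ) / (Q : ℚ)⌉ with hu
  set v := ⌈((b - c : ℤ) : ℚ) / (Q : ℚ)⌉ with hv
  refine ⟨(c : ZMod p) / Q + u, (v - u).toNat, ?_, ?_⟩
  · have h1 : ((v - u : ℤ) : ℚ) ≤ (b - a) / Q + 1 := by
      have h2 := Int.ceil_lt_add_one (((b - c : ℤ) : ℚ) / (Q : ℚ))
      have h3 := Int.le_ceil (((a - c : ℤ) : ℚ) / (Q : ℚ))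
      rw [← hv] at h2
      rw [← hu] at h3
      have h4 : ((b - c : ℤ) : ℚ) / (Q : ℚ) - ((a - c : ℤ) : ℚ) / (Q : ℚ) = (b - a) / Q := by
        push_cast
        ring
      push_cast at h2 h3 h4 ⊢
      linarith
    have h1' : ((v - u : ℤ) : ℝ) ≤ (b - a) / Q + 1 := by exact_mod_cast h1
    rcases le_total 0 (v - u) with h | h
    · apply le_max_of_le_right
      rw [← Int.cast_natCast, Int.toNat_of_nonneg h]
      exact h1'
    · rw [Int.toNat_of_nonpos h]
      simp
  · rw [← sum_Ico_realQuadraticChar]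
    have h5 : ∀ k : ℤ, realQuadraticChar p ((k * Q + c : ℤ) : ZMod p) =
        realQuadraticChar p Q * realQuadraticChar p ((c : ZMod p) / Q + k) := by
      intro k
      rw [← realQuadraticChar_mul]
      congr 1
      push_cast
      field_simp
      ring
    simp only [Function.Embedding.coeFn_mk, h5]
    rw [← Finset.mul_sum, abs_mul]
    exact mul_le_of_le_one_left (abs_nonneg _) (abs_realQuadraticChar_le_one _)

lemma abs_sum_dvd_realQuadraticChar_le (hp2 : p ≠ 2) {a b a₀ : ℤ} {W δ : ℕ} (hW : 0 < W)
    (hδ : 0 < δ) {Y c θ : ℝ} (hY : 1 / 4 ≤ Y) (hc : 0 ≤ c) (hθ1 : θ ≤ 1)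
    (hab : (b - a : ℝ) ≤ Y + 1) (hI : ∀ m ∈ Finset.Ico a b, m ≠ 0 ∧ |(m : ℝ)| < 2 * Y)
    (hE : ∀ (M : ZMod p) (N : ℕ), (N : ℝ) ≤ 7 * Y → |shortCharSum p M N| ≤ c * (N : ℝ) ^ (1 - θ)) :
    |∑ m ∈ (Finset.Ico a b).filter
        (fun m => m ≡ a₀ [ZMOD 4] ∧ (W : ℤ) ∣ m ∧ (δ : ℤ) ∣ m), realQuadraticChar p (m : ZMod p)|
      ≤ c * (7 * Y / W) ^ (1 - θ) := by
  have hrhs : 0 ≤ c * (7 * Y / W) ^ (1 - θ) := by positivity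
  rcases Finset.eq_empty_or_nonempty ((Finset.Ico a b).filter
    (fun m => m ≡ a₀ [ZMOD 4] ∧ (W : ℤ) ∣ m ∧ (δ : ℤ) ∣ m)) with h | ⟨m₀, h⟩
  · rw [h]
    simpa using hrhs
  rw [Finset.mem_filter] at h
  obtain ⟨hm₀, h4, hWm, hδm⟩ := h
  set Q : ℕ := Nat.lcm 4 (Nat.lcm W δ) with hQ
  have hQ0 : 0 < Q := Nat.lcm_pos (by norm_num) (Nat.lcm_pos hW hδ)
  have hset : (Finset.Ico a b).filter
      (fun m => m ≡ a₀ [ZMOD 4] ∧ (W : ℤ) ∣ m ∧ (δ : ℤ) ∣ m)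
      = (Finset.Ico a b).filter (fun m => m ≡ m₀ [ZMOD (Q : ℤ)]) := by
    refine Finset.filter_congr fun m _ => ?_
    have h1 : m ≡ m₀ [ZMOD (Q : ℤ)] ↔ (4 : ℤ) ∣ m - m₀ ∧ (W : ℤ) ∣ m - m₀ ∧ (δ : ℤ) ∣ m - m₀ := by
      rw [Int.modEq_comm, Int.modEq_iff_dvd, Int.natCast_dvd, hQ, Nat.lcm_dvd_iff,
        Nat.lcm_dvd_iff, ← Int.natCast_dvd, ← Int.natCast_dvd, ← Int.natCast_dvd]
      rfl
    rw [h1, dvd_sub_left hWm, dvd_sub_left hδm]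
    have h2 : m ≡ a₀ [ZMOD 4] ↔ (4 : ℤ) ∣ m - m₀ := by
      rw [← Int.modEq_iff_dvd]
      exact ⟨fun h => h4.trans h.symm, fun h => h.symm.trans h4⟩
    rw [h2]
  by_cases hpQ : ((Q : ℤ) : ZMod p) = 0
  · have hpp : Nat.Prime p := Fact.out
    have h1 : p ∣ Q := by
      rw [Int.cast_natCast] at hpQ
      exact (ZMod.natCast_eq_zero_iff _ _).mp hpQ
    have h2 : p ∣ W ∨ p ∣ δ := by
      have h3 : p ∣ 4 * (W * δ) := h1.trans ((Nat.lcm_dvd_mul 4 _).trans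
        (mul_dvd_mul_left 4 (Nat.lcm_dvd_mul W δ)))
      rw [hpp.dvd_mul, hpp.dvd_mul] at h3
      rcases h3 with h3 | h3
      · have : p ∣ 2 := hpp.dvd_of_dvd_pow (show p ∣ 2 ^ 2 by simpa using h3)
        exact absurd ((Nat.prime_dvd_prime_iff_eq hpp Nat.prime_two).mp this) hp2
      · exact h3
    rw [Finset.sum_eq_zero]
    · simpa using hrhs
    · intro m hm
      rw [Finset.mem_filter] at hm
      have h3 : (p : ℤ) ∣ m := by
        rcases h2 with h2 | h2
        · exact (Int.natCast_dvd_natCast.mpr h2).trans hm.2.2.1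
        · exact (Int.natCast_dvd_natCast.mpr h2).trans hm.2.2.2
      rw [(ZMod.intCast_zmod_eq_zero_iff_dvd m p).mpr h3, realQuadraticChar_zero]
  · obtain ⟨M, N, hN, hle⟩ := abs_sum_modEq_realQuadraticChar_le (a := a) (b := b) (c := m₀)
      (Q := (Q : ℤ)) (by exact_mod_cast hQ0) hpQ
    rw [hset]
    have hW0 : (0 : ℝ) < W := by exact_mod_cast hW
    have hW1 : (1 : ℝ) ≤ W := by exact_mod_cast hW
    have hWQ : (W : ℝ) ≤ Q := by
      exact_mod_cast Nat.le_of_dvd hQ0 ((Nat.dvd_lcm_left W δ).trans (Nat.dvd_lcm_right 4 _))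
    have hWY : (W : ℝ) ≤ 2 * Y := by
      obtain ⟨hm0, hm1⟩ := hI m₀ hm₀
      have h1 : (W : ℤ) ≤ |m₀| := Int.le_of_dvd (abs_pos.mpr hm0) ((dvd_abs _ _).mpr hWm)
      have h2 : (W : ℝ) ≤ |(m₀ : ℝ)| := by exact_mod_cast h1
      linarith
    have hN7 : (N : ℝ) ≤ 7 * Y / W := by
      refine hN.trans (max_le (div_nonneg (by linarith) hW0.le) ?_)
      have h1 : (b - a : ℝ) / ((Q : ℤ) : ℝ) ≤ (Y + 1) / W := by
        rw [Int.cast_natCast]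
        calc (b - a : ℝ) / Q ≤ (Y + 1) / Q := by gcongr
          _ ≤ _ := by gcongr
      have h2 : (1 : ℝ) ≤ 2 * Y / W := by rwa [le_div_iff₀ hW0, one_mul]
      have h3 : (Y + 1) / W + 2 * Y / W ≤ 7 * Y / W := by
        rw [← add_div]
        gcongr
        linarith
      linarith
    have hN7' : (N : ℝ) ≤ 7 * Y := hN7.trans (div_le_self (by linarith) hW1)
    refine hle.trans ((hE M N hN7').trans ?_)
    gcongr

end Sieve

section Sieve

open ArithmeticFunction in
lemma ite_squarefree_coprime_eq_sum {D R : ℕ} (hD : D ≠ 0) {m : ℤ} (hm : m ≠ 0)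
    (hR : m.natAbs ≤ R) {P : Prop} [Decidable P] (x : ℝ)
    [Decidable (P ∧ Squarefree m ∧ IsCoprime m (D : ℤ))] :
    (if P ∧ Squarefree m ∧ IsCoprime m (D : ℤ) then x else 0) =
      ∑ d ∈ Finset.Icc 1 R, ∑ δ ∈ D.divisors, ((moebius d : ℝ) * (moebius δ : ℝ)) *
        (if P ∧ ((d ^ 2 : ℕ) : ℤ) ∣ m ∧ (δ : ℤ) ∣ m then x else 0) := by
  have h1 := sum_moebius_sq_dvd (Int.natAbs_ne_zero.mpr hm) hR
  have h2 := sum_moebius_dvd_coprime (n := m.natAbs) hD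
  have h3 : ∀ d δ : ℕ, ((moebius d : ℝ) * (moebius δ : ℝ)) *
      (if P ∧ ((d ^ 2 : ℕ) : ℤ) ∣ m ∧ (δ : ℤ) ∣ m then x else 0) =
      (if P then x else 0) * (((if d ^ 2 ∣ m.natAbs then moebius d else 0 : ℤ) : ℝ) *
        ((if δ ∣ m.natAbs then moebius δ else 0 : ℤ) : ℝ)) := by
    intro d δ
    have e1 : ((d ^ 2 : ℕ) : ℤ) ∣ m ↔ d ^ 2 ∣ m.natAbs := Int.natCast_dvd
    have e2 : (δ : ℤ) ∣ m ↔ δ ∣ m.natAbs := Int.natCast_dvd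
    by_cases hP : P <;> by_cases hd : d ^ 2 ∣ m.natAbs <;> by_cases hδ : δ ∣ m.natAbs <;>
      simp only [hP, e1, e2, hd, hδ, if_true, if_false, and_true, and_false, Int.cast_zero,
        mul_zero, zero_mul, mul_comm]
  simp only [h3]
  simp only [← Finset.mul_sum, ← Finset.sum_mul]
  rw [← Int.cast_sum, ← Int.cast_sum, h1, h2]
  have h4 : m.natAbs.Coprime D ↔ IsCoprime m (D : ℤ) := by
    rw [Int.isCoprime_iff_gcd_eq_one]
    rfl
  by_cases hP : P <;> by_cases hs : Squarefree m <;> by_cases hc : IsCoprime m (D : ℤ) <;>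
    simp [hP, Int.squarefree_natAbs, hs, h4, hc]

variable {p : ℕ} [Fact p.Prime]

lemma abs_sum_squarefree_Ico_le (hp2 : p ≠ 2) {a b a₀ : ℤ} {D : ℕ} (hD : D ≠ 0)
    {Y c θ : ℝ} (hY : 1 / 4 ≤ Y) (hc : 0 ≤ c) (hθ0 : 0 ≤ θ) (hθ1 : θ ≤ 1 / 3)
    (hab : (b - a : ℝ) ≤ Y + 1) (hI : ∀ m ∈ Finset.Ico a b, m ≠ 0 ∧ |(m : ℝ)| < 2 * Y)
    (hE : ∀ (M : ZMod p) (N : ℕ), (N : ℝ) ≤ 7 * Y → |shortCharSum p M N| ≤ c * (N : ℝ) ^ (1 - θ))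
    [DecidablePred fun m : ℤ => m ≡ a₀ [ZMOD 4] ∧ Squarefree m ∧ IsCoprime m (D : ℤ)] :
    |∑ m ∈ (Finset.Ico a b).filter
        (fun m => m ≡ a₀ [ZMOD 4] ∧ Squarefree m ∧ IsCoprime m (D : ℤ)),
        realQuadraticChar p (m : ZMod p)|
      ≤ 7 * (∑' n : ℕ, 1 / (n : ℝ) ^ (4 / 3 : ℝ)) * (D.divisors.card : ℝ) * (c * Y ^ (1 - θ)) := by
  have hY0 : 0 < Y := by linarith
  have hsum : Summable fun n : ℕ => 1 / (n : ℝ) ^ (4 / 3 : ℝ) :=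
    Real.summable_one_div_nat_rpow.mpr (by norm_num)
  set R := ⌊2 * Y⌋₊ with hR
  have h1 : ∑ m ∈ (Finset.Ico a b).filter
        (fun m => m ≡ a₀ [ZMOD 4] ∧ Squarefree m ∧ IsCoprime m (D : ℤ)),
        realQuadraticChar p (m : ZMod p) =
      ∑ d ∈ Finset.Icc 1 R, ∑ δ ∈ D.divisors,
        ((ArithmeticFunction.moebius d : ℝ) * (ArithmeticFunction.moebius δ : ℝ)) *
        ∑ m ∈ (Finset.Ico a b).filter
        (fun m => m ≡ a₀ [ZMOD 4] ∧ ((d ^ 2 : ℕ) : ℤ) ∣ m ∧ (δ : ℤ) ∣ m),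
          realQuadraticChar p (m : ZMod p) := by
    rw [Finset.sum_filter]
    have h2 : ∀ m ∈ Finset.Ico a b,
        (if m ≡ a₀ [ZMOD 4] ∧ Squarefree m ∧ IsCoprime m (D : ℤ) then
          realQuadraticChar p (m : ZMod p) else 0) =
        ∑ d ∈ Finset.Icc 1 R, ∑ δ ∈ D.divisors,
          ((ArithmeticFunction.moebius d : ℝ) * (ArithmeticFunction.moebius δ : ℝ)) *
          (if m ≡ a₀ [ZMOD 4] ∧ ((d ^ 2 : ℕ) : ℤ) ∣ m ∧ (δ : ℤ) ∣ m then
            realQuadraticChar p (m : ZMod p) else 0) := by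
      intro m hm
      obtain ⟨h3, h4⟩ := hI m hm
      refine ite_squarefree_coprime_eq_sum (R := R) hD h3 ?_ _
      apply Nat.le_floor
      rw [Nat.cast_natAbs, Int.cast_abs]
      exact h4.le
    rw [Finset.sum_congr rfl h2, Finset.sum_comm]
    refine Finset.sum_congr rfl fun d _ => ?_
    rw [Finset.sum_comm]
    refine Finset.sum_congr rfl fun δ _ => ?_
    rw [← Finset.mul_sum, Finset.sum_filter]
  have hμ : ∀ n : ℕ, |(ArithmeticFunction.moebius n : ℝ)| ≤ 1 := by
    intro n
    exact_mod_cast ArithmeticFunction.abs_moebius_le_one (n := n)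
  have h2 : ∀ d ∈ Finset.Icc 1 R, |∑ δ ∈ D.divisors,
        ((ArithmeticFunction.moebius d : ℝ) * (ArithmeticFunction.moebius δ : ℝ)) *
        ∑ m ∈ (Finset.Ico a b).filter
        (fun m => m ≡ a₀ [ZMOD 4] ∧ ((d ^ 2 : ℕ) : ℤ) ∣ m ∧ (δ : ℤ) ∣ m),
          realQuadraticChar p (m : ZMod p)| ≤
      (D.divisors.card : ℝ) * (7 * (c * Y ^ (1 - θ))) * (1 / (d : ℝ) ^ (4 / 3 : ℝ)) := by
    intro d hd
    have hd1 : 1 ≤ d := (Finset.mem_Icc.mp hd).1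
    have hd1' : (1 : ℝ) ≤ d := by exact_mod_cast hd1
    have hd0 : (0 : ℝ) < d := by linarith
    refine (Finset.abs_sum_le_sum_abs _ _).trans ?_
    rw [mul_assoc, ← nsmul_eq_mul]
    refine Finset.sum_le_card_nsmul _ _ _ fun δ hδ => ?_
    rw [abs_mul, abs_mul]
    have h3 := abs_sum_dvd_realQuadraticChar_le hp2 (a₀ := a₀) (W := d ^ 2) (δ := δ)
      (by positivity) (Nat.pos_of_mem_divisors hδ) hY hc (by linarith) hab hI hE
    have h4 : |(ArithmeticFunction.moebius d : ℝ)| * |(ArithmeticFunction.moebius δ : ℝ)| ≤ 1 :=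
      mul_le_one₀ (hμ d) (abs_nonneg _) (hμ δ)
    refine (mul_le_of_le_one_left (abs_nonneg _) h4).trans (h3.trans ?_)
    have h5 : (d : ℝ) ^ (4 / 3 : ℝ) ≤ (((d ^ 2 : ℕ)) : ℝ) ^ (1 - θ) := by
      push_cast
      rw [← Real.rpow_natCast, ← Real.rpow_mul hd0.le]
      apply Real.rpow_le_rpow_of_exponent_le hd1'
      push_cast
      linarith
    calc c * (7 * Y / (d ^ 2 : ℕ)) ^ (1 - θ)
        = c * (7 ^ (1 - θ) * Y ^ (1 - θ) / ((d ^ 2 : ℕ) : ℝ) ^ (1 - θ)) := by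
          rw [Real.div_rpow (by positivity) (by positivity), Real.mul_rpow (by norm_num) hY0.le]
      _ ≤ c * (7 * Y ^ (1 - θ) / (d : ℝ) ^ (4 / 3 : ℝ)) := by
          gcongr
          exact Real.rpow_le_self_of_one_le (by norm_num) (by linarith)
      _ = _ := by ring
  rw [h1]
  refine (Finset.abs_sum_le_sum_abs _ _).trans ((Finset.sum_le_sum h2).trans ?_)
  rw [← Finset.mul_sum]
  have h3 := hsum.sum_le_tsum (Finset.Icc 1 R) fun n _ => by positivity
  calc _ ≤ (D.divisors.card : ℝ) * (7 * (c * Y ^ (1 - θ))) *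
        (∑' n : ℕ, 1 / (n : ℝ) ^ (4 / 3 : ℝ)) := by gcongr
    _ = _ := by ring

/-- The squarefree integers `m ≡ a₀ (mod 4)` coprime to `D` with `Y ≤ |m| < 2Y`. -/
def squarefreeDyadic (D : ℕ) (a₀ : ℤ) (Y : ℝ) : Set ℤ :=
  {m | m ≡ a₀ [ZMOD 4] ∧ Squarefree m ∧ IsCoprime m (D : ℤ) ∧ Y ≤ |(m : ℝ)| ∧ |(m : ℝ)| < 2 * Y}

lemma squarefreeDyadic_eq (D : ℕ) (a₀ : ℤ) {Y : ℝ} (hY : 0 < Y)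
    [DecidablePred fun m : ℤ => m ≡ a₀ [ZMOD 4] ∧ Squarefree m ∧ IsCoprime m (D : ℤ)] :
    squarefreeDyadic D a₀ Y =
      (((Finset.Ico ⌈Y⌉ ⌈2 * Y⌉).filter
        (fun m => m ≡ a₀ [ZMOD 4] ∧ Squarefree m ∧ IsCoprime m (D : ℤ)) ∪
      (Finset.Ico (-⌈2 * Y⌉ + 1) (-⌈Y⌉ + 1)).filter
        (fun m => m ≡ a₀ [ZMOD 4] ∧ Squarefree m ∧ IsCoprime m (D : ℤ)) : Finset ℤ) : Set ℤ) := by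
  ext m
  have h1 : (Y ≤ |(m : ℝ)| ∧ |(m : ℝ)| < 2 * Y) ↔
      m ∈ Finset.Ico ⌈Y⌉ ⌈2 * Y⌉ ∨ m ∈ Finset.Ico (-⌈2 * Y⌉ + 1) (-⌈Y⌉ + 1) := by
    have e1 : (-⌈2 * Y⌉ + 1 ≤ m) ↔ -(m : ℝ) < 2 * Y := by
      have h := Int.lt_ceil (a := 2 * Y) (z := -m)
      push_cast at h
      rw [← h]
      omega
    have e2 : (m < -⌈Y⌉ + 1) ↔ Y ≤ -(m : ℝ) := by
      have h := Int.ceil_le (a := Y) (z := -m)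
      push_cast at h
      rw [← h]
      omega
    rw [Finset.mem_Ico, Finset.mem_Ico, Int.ceil_le, Int.lt_ceil, e1, e2]
    rcases abs_cases (m : ℝ) with ⟨h, h'⟩ | ⟨h, h'⟩ <;> rw [h]
    · refine ⟨fun h => Or.inl h, fun h => ?_⟩
      rcases h with h | h
      · exact h
      · linarith
    · refine ⟨fun h => Or.inr ⟨h.2, h.1⟩, fun h => ?_⟩
      rcases h with h | h
      · linarith
      · exact ⟨h.2, h.1⟩
  rw [Finset.mem_coe, Finset.mem_union, Finset.mem_filter, Finset.mem_filter, ← or_and_right, ← h1]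
  simp only [squarefreeDyadic, Set.mem_ofPred_eq]
  tauto

lemma squarefreeDyadic_finite (D : ℕ) (a₀ : ℤ) {Y : ℝ} (hY : 0 < Y) :
    (squarefreeDyadic D a₀ Y).Finite := by
  classical
  rw [squarefreeDyadic_eq D a₀ hY]
  exact Finset.finite_toSet _

lemma abs_finsum_squarefreeDyadic_le (hp2 : p ≠ 2) {a₀ : ℤ} {D : ℕ} (hD : D ≠ 0)
    {Y c θ : ℝ} (hY : 1 / 4 ≤ Y) (hc : 0 ≤ c) (hθ0 : 0 ≤ θ) (hθ1 : θ ≤ 1 / 3)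
    (hE : ∀ (M : ZMod p) (N : ℕ), (N : ℝ) ≤ 7 * Y → |shortCharSum p M N| ≤ c * (N : ℝ) ^ (1 - θ)) :
    |∑ᶠ m ∈ squarefreeDyadic D a₀ Y, realQuadraticChar p (m : ZMod p)|
      ≤ 14 * (∑' n : ℕ, 1 / (n : ℝ) ^ (4 / 3 : ℝ)) * (D.divisors.card : ℝ) *
        (c * Y ^ (1 - θ)) := by
  classical
  have hY0 : 0 < Y := by linarith
  have hc1 : 0 < ⌈Y⌉ := Int.ceil_pos.mpr hY0
  have hb : ((⌈2 * Y⌉ : ℝ) - ⌈Y⌉) ≤ Y + 1 := by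
    linarith [Int.ceil_lt_add_one (2 * Y), Int.le_ceil Y]
  rw [squarefreeDyadic_eq D a₀ hY0, finsum_mem_coe_finset, Finset.sum_union]
  · refine (abs_add_le _ _).trans ?_
    have h1 := abs_sum_squarefree_Ico_le hp2 (a := ⌈Y⌉) (b := ⌈2 * Y⌉) (a₀ := a₀) hD hY hc hθ0 hθ1
      hb (by
        intro m hm
        rw [Finset.mem_Ico, Int.lt_ceil] at hm
        refine ⟨by omega, ?_⟩
        rw [abs_of_nonneg (by exact_mod_cast (by omega : 0 ≤ m))]
        exact hm.2) hE
    have h2 := abs_sum_squarefree_Ico_le hp2 (a := -⌈2 * Y⌉ + 1) (b := -⌈Y⌉ + 1) (a₀ := a₀) hD hY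
      hc hθ0 hθ1 (by push_cast; linarith) (by
        intro m hm
        rw [Finset.mem_Ico] at hm
        refine ⟨by omega, ?_⟩
        rw [abs_of_neg (by exact_mod_cast (by omega : m < 0))]
        have h := Int.lt_ceil (a := 2 * Y) (z := -m)
        push_cast at h
        rw [← h]
        omega) hE
    linarith
  · rw [Finset.disjoint_left]
    intro m hm hm'
    rw [Finset.mem_filter, Finset.mem_Ico] at hm hm'
    omega

end Sieve

end

section Sieve

lemma FSet_eq (D : ℕ) (X : ℝ) : FSet D X = squarefreeDyadic D 1 X ∪ (fun m : ℤ => 4 * m) ''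
    {m | m ∈ squarefreeDyadic D 2 (X / 4) ∪ squarefreeDyadic D 3 (X / 4) ∧
      IsCoprime 4 (D : ℤ)} := by
  ext f
  have h4 : ∀ m : ℤ, |((4 * m : ℤ) : ℝ)| = 4 * |(m : ℝ)| := by
    intro m
    push_cast
    rw [abs_mul]
    norm_num
  constructor
  · rintro ⟨hf | ⟨m, rfl, hm, hm4⟩, hco, hX, hX'⟩
    · exact Or.inl ⟨hf.1, hf.2, hco, hX, hX'⟩
    · rw [h4] at hX hX'
      rw [IsCoprime.mul_left_iff] at hco
      refine Or.inr ⟨m, ⟨?_, hco.1⟩, rfl⟩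
      rcases hm4 with hm4 | hm4
      · exact Or.inl ⟨hm4, hm, hco.2, by linarith, by linarith⟩
      · exact Or.inr ⟨hm4, hm, hco.2, by linarith, by linarith⟩
  · rintro (⟨hf, hs, hco, hX, hX'⟩ | ⟨m, ⟨hm | hm, hc⟩, rfl⟩)
    · exact ⟨Or.inl ⟨hf, hs⟩, hco, hX, hX'⟩
    all_goals
      obtain ⟨hm4, hs, hco, hX, hX'⟩ := hm
      refine ⟨Or.inr ⟨m, rfl, hs, ?_⟩, IsCoprime.mul_left_iff.mpr ⟨hc, hco⟩, ?_, ?_⟩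
    · exact Or.inl hm4
    · rw [h4]; linarith
    · rw [h4]; linarith
    · exact Or.inr hm4
    · rw [h4]; linarith
    · rw [h4]; linarith

lemma finsum_legendreSym_FSet_eq (p : ℕ) [Fact p.Prime] (D : ℕ) {X : ℝ} (hX : 0 < X) :
    ∃ t : ℝ, |t| ≤ 1 ∧ ∑ᶠ f ∈ FSet D X, ((legendreSym p f : ℤ) : ℝ) =
      ∑ᶠ m ∈ squarefreeDyadic D 1 X, realQuadraticChar p (m : ZMod p) +
      t * (∑ᶠ m ∈ squarefreeDyadic D 2 (X / 4), realQuadraticChar p (m : ZMod p) +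
        ∑ᶠ m ∈ squarefreeDyadic D 3 (X / 4), realQuadraticChar p (m : ZMod p)) := by
  have hf1 := squarefreeDyadic_finite D 1 hX
  have hf2 := squarefreeDyadic_finite D 2 (show 0 < X / 4 by positivity)
  have hf3 := squarefreeDyadic_finite D 3 (show 0 < X / 4 by positivity)
  change ∃ t : ℝ, |t| ≤ 1 ∧ ∑ᶠ f ∈ FSet D X, realQuadraticChar p (f : ZMod p) = _
  rw [FSet_eq]
  by_cases h4 : IsCoprime 4 (D : ℤ)
  · refine ⟨realQuadraticChar p 4, abs_realQuadraticChar_le_one _, ?_⟩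
    simp only [h4, and_true, Set.ofPred_mem_eq]
    rw [finsum_mem_union _ hf1 ((hf2.union hf3).image _),
      finsum_mem_image (by intro a _ b _ h; simpa using h), ← finsum_mem_union _ hf2 hf3,
      mul_finsum_mem]
    · congr 1
      refine finsum_mem_congr rfl fun m _ => ?_
      rw [← realQuadraticChar_mul]
      push_cast
      rfl
    · rw [Set.disjoint_left]
      rintro m ⟨h, -⟩ ⟨h', -⟩
      have := h.symm.trans h'
      revert this
      decide
    · rw [Set.disjoint_left]
      rintro f ⟨h, -⟩ ⟨m, -, rfl⟩
      change (4 * m) % 4 = 1 % 4 at h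
      omega
  · refine ⟨0, by simp, ?_⟩
    simp [h4]

/-- A power-saving bound for all short sums of the quadratic character gives one for its sum over
fundamental discriminants coprime to `D`. -/
theorem abs_finsum_legendreSym_FSet_le {p : ℕ} [Fact p.Prime] (hp2 : p ≠ 2) {D : ℕ} (hD : D ≠ 0)
    {X c θ : ℝ} (hX : 1 ≤ X) (hc : 0 ≤ c) (hθ0 : 0 ≤ θ) (hθ1 : θ ≤ 1 / 3)
    (hE : ∀ (M : ZMod p) (N : ℕ), (N : ℝ) ≤ 7 * X → |shortCharSum p M N| ≤ c * (N : ℝ) ^ (1 - θ)) :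
    |∑ᶠ f ∈ FSet D X, ((legendreSym p f : ℤ) : ℝ)| ≤
      42 * (∑' n : ℕ, 1 / (n : ℝ) ^ (4 / 3 : ℝ)) * (D.divisors.card : ℝ) * (c * X ^ (1 - θ)) := by
  obtain ⟨t, ht, h⟩ := finsum_legendreSym_FSet_eq p D (show 0 < X by linarith)
  have hE' : ∀ (M : ZMod p) (N : ℕ), (N : ℝ) ≤ 7 * (X / 4) →
      |shortCharSum p M N| ≤ c * (N : ℝ) ^ (1 - θ) := fun M N hN => hE M N (by linarith)
  have h1 := abs_finsum_squarefreeDyadic_le hp2 (a₀ := 1) hD (by linarith) hc hθ0 hθ1 hE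
  have h2 := abs_finsum_squarefreeDyadic_le hp2 (a₀ := 2) hD (by linarith) hc hθ0 hθ1 hE'
  have h3 := abs_finsum_squarefreeDyadic_le hp2 (a₀ := 3) hD (by linarith) hc hθ0 hθ1 hE'
  have hS : 0 ≤ ∑' n : ℕ, 1 / (n : ℝ) ^ (4 / 3 : ℝ) := tsum_nonneg fun n => by positivity
  have h4 : 14 * (∑' n : ℕ, 1 / (n : ℝ) ^ (4 / 3 : ℝ)) * (D.divisors.card : ℝ) *
        (c * (X / 4) ^ (1 - θ)) ≤ 14 * (∑' n : ℕ, 1 / (n : ℝ) ^ (4 / 3 : ℝ)) *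
        (D.divisors.card : ℝ) * (c * X ^ (1 - θ)) := by
    have : 0 ≤ X / 4 := by linarith
    gcongr
    · linarith
    · linarith
  rw [h]
  refine (abs_add_le _ _).trans ?_
  have h5 := abs_add_le (∑ᶠ m ∈ squarefreeDyadic D 2 (X / 4), realQuadraticChar p (m : ZMod p))
    (∑ᶠ m ∈ squarefreeDyadic D 3 (X / 4), realQuadraticChar p (m : ZMod p))
  rw [abs_mul]
  have h6 := mul_le_of_le_one_left (abs_nonneg
    (∑ᶠ m ∈ squarefreeDyadic D 2 (X / 4), realQuadraticChar p (m : ZMod p) +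
      ∑ᶠ m ∈ squarefreeDyadic D 3 (X / 4), realQuadraticChar p (m : ZMod p))) ht
  linarith

end Sieve

section Exponents

variable {ε u : ℝ}

lemma saving_exponent_ge (hε : 0 < ε) (hε1 : ε ≤ 197 / 1000) (hu : 2 * ε ≤ u * (1 + 2 * ε))
    (hu2 : u ≤ 2 * ε) : ε ^ 2 ≤ (1 - 3 * ε ^ 2) * ((u - u ^ 2) / 4 - ε ^ 2 / 100) := by
  have hu0 : 0 < u := by
    by_contra h
    nlinarith
  have h1 : 1.434 * ε ≤ u := by nlinarith
  have h2 : 1.027 * ε ≤ u - u ^ 2 := by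
    nlinarith [mul_nonneg (sub_nonneg.mpr h1) (sub_nonneg.mpr hu2),
      mul_nonneg (sub_nonneg.mpr h1) (sub_nonneg.mpr hε1),
      mul_nonneg hε.le (sub_nonneg.mpr hε1)]
  have h3 : 0.25 * ε ≤ (u - u ^ 2) / 4 - ε ^ 2 / 100 := by nlinarith
  have h4 : 0.88 ≤ 1 - 3 * ε ^ 2 := by nlinarith
  calc ε ^ 2 ≤ 0.88 * (0.25 * ε) := by nlinarith
    _ ≤ _ := by gcongr

lemma main_exponent_le (hε : 0 < ε) (hε1 : ε ≤ 197 / 1000) (hu : 2 * ε ≤ u * (1 + 2 * ε))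
    (hu2 : u ≤ 2 * ε) :
    (4 - 16 * ε) * ((u + u ^ 2) / 4 + ε ^ 2 / 100) + (1 - u) ≤ 1 - ε ^ 2 := by
  have hu0 : 0 < u := by
    by_contra h
    nlinarith
  have h1 : 1.434 * ε ≤ u := by nlinarith
  have h2 : u * (u - 4 * ε - 4 * ε * u) ≤ u * (-2 * ε) := by
    gcongr
    nlinarith
  have h3 : 0 ≤ ε ^ 3 := by positivity
  nlinarith

end Exponents

section Main

variable {p : ℕ} [Fact p.Prime]

lemma abs_shortCharSum_le_rpow_third (hp2 : p ≠ 2) (M : ZMod p) (N : ℕ) :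
    |shortCharSum p M N| ≤ (p : ℝ) ^ (1 / 3 : ℝ) * (N : ℝ) ^ (1 - 1 / 3 : ℝ) := by
  have h1 := abs_shortCharSum_le M N
  have h2 := abs_shortCharSum_le_prime hp2 M N
  have h0 := abs_nonneg (shortCharSum p M N)
  calc |shortCharSum p M N|
      = |shortCharSum p M N| ^ (1 / 3 : ℝ) * |shortCharSum p M N| ^ (1 - 1 / 3 : ℝ) := by
        rw [← Real.rpow_add' h0 (by norm_num)]
        norm_num
    _ ≤ _ := by gcongr

lemma rpow_third_mul_le {X ε P : ℝ} (hX : 1 ≤ X) (hP : 0 ≤ P) (h : P ≤ X ^ (1 - 3 * ε ^ 2)) :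
    P ^ (1 / 3 : ℝ) * X ^ (1 - 1 / 3 : ℝ) ≤ X ^ (1 - ε ^ 2) := by
  have hX0 : 0 < X := by linarith
  calc P ^ (1 / 3 : ℝ) * X ^ (1 - 1 / 3 : ℝ)
      ≤ (X ^ (1 - 3 * ε ^ 2)) ^ (1 / 3 : ℝ) * X ^ (1 - 1 / 3 : ℝ) := by gcongr
    _ = X ^ (1 - ε ^ 2) := by
      rw [← Real.rpow_mul hX0.le, ← Real.rpow_add hX0]
      congr 1
      ring

lemma lt_rpow_of_lt_sqrt_mul_rpow {D X σ ε P : ℝ} (hD : 0 < D) (hX : 1 ≤ X)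
    (h : D ^ (σ / 2) < X ^ (4 - σ - 16 * ε)) (hP : P < (Real.sqrt D * X) ^ σ) :
    P < X ^ (4 - 16 * ε) := by
  have hX0 : 0 < X := by linarith
  calc P < (Real.sqrt D * X) ^ σ := hP
    _ = D ^ (σ / 2) * X ^ σ := by
      rw [Real.mul_rpow (Real.sqrt_nonneg _) hX0.le, Real.sqrt_eq_rpow, ← Real.rpow_mul hD.le]
      congr 2
      ring
    _ ≤ X ^ (4 - σ - 16 * ε) * X ^ σ := by gcongr
    _ = X ^ (4 - 16 * ε) := by
      rw [← Real.rpow_add hX0]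
      congr 1
      ring

lemma burgess_factor_mul_le {X ε u P α β : ℝ} (hX : 1 ≤ X) (hα : 0 ≤ α) (hβ : 0 ≤ β)
    (hP : X ^ (1 - 3 * ε ^ 2) < P) (hP' : P < X ^ (4 - 16 * ε))
    (h1 : (4 - 16 * ε) * α + (1 - u) ≤ 1 - ε ^ 2) (h2 : ε ^ 2 ≤ (1 - 3 * ε ^ 2) * β) :
    (P ^ α + 7 * X ^ u * P ^ (-β)) * X ^ (1 - u) ≤ 8 * X ^ (1 - ε ^ 2) := by
  have hX0 : 0 < X := by linarith
  have hP0 : 0 < P := lt_trans (by positivity) hP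
  have h3 : P ^ α * X ^ (1 - u) ≤ X ^ (1 - ε ^ 2) := by
    calc P ^ α * X ^ (1 - u) ≤ (X ^ (4 - 16 * ε)) ^ α * X ^ (1 - u) := by gcongr
      _ = X ^ ((4 - 16 * ε) * α + (1 - u)) := by
        rw [← Real.rpow_mul hX0.le, ← Real.rpow_add hX0]
      _ ≤ _ := Real.rpow_le_rpow_of_exponent_le hX h1
  have h4 : X ^ u * P ^ (-β) * X ^ (1 - u) ≤ X ^ (1 - ε ^ 2) := by
    calc X ^ u * P ^ (-β) * X ^ (1 - u) ≤ X ^ u * (X ^ (1 - 3 * ε ^ 2)) ^ (-β) * X ^ (1 - u) := by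
          gcongr ?_ * ?_ * _
          exact Real.rpow_le_rpow_of_nonpos (by positivity) hP.le (by linarith)
      _ = X ^ (u + (1 - 3 * ε ^ 2) * (-β) + (1 - u)) := by
        rw [← Real.rpow_mul hX0.le, ← Real.rpow_add hX0, ← Real.rpow_add hX0]
      _ ≤ _ := Real.rpow_le_rpow_of_exponent_le hX (by linarith)
  linarith

end Main

/-- For every `ε > 0` there is `C(ε) > 0` such that for all `σ > 0`,
`D ≥ 1` and `X ≥ 1` with `D^{σ/2} < X^{4−σ−16ε}`, and every odd prime
`p < (√D·X)^σ`, one has `|∑_{f ∈ F(X)} (f/p)| ≤ C(ε)·τ(D)·X^{1−ε²}`. -/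
theorem legendre_char_sum_fund_disc (ε : ℝ) (hε : 0 < ε) :
    ∃ C : ℝ, 0 < C ∧ ∀ σ : ℝ, 0 < σ → ∀ (D : ℕ), 0 < D → ∀ X : ℝ, 1 ≤ X →
      (D : ℝ) ^ (σ / 2) < X ^ (4 - σ - 16 * ε) →
      ∀ (p : ℕ) [Fact p.Prime], p ≠ 2 → (p : ℝ) < (Real.sqrt D * X) ^ σ →
      |∑ᶠ f ∈ FSet D X, ((legendreSym p f : ℤ) : ℝ)|
        ≤ C * (D.divisors.card : ℝ) * X ^ (1 - ε ^ 2) := by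
  rcases le_or_gt (1 / 4) ε with hε4 | hε4
  · refine ⟨1, one_pos, fun σ hσ D hD X hX h p _ hp2 hp => ?_⟩
    have h1 : (1 : ℝ) ≤ (D : ℝ) ^ (σ / 2) :=
      Real.one_le_rpow (by exact_mod_cast hD) (by positivity)
    have h2 : X ^ (4 - σ - 16 * ε) ≤ 1 := Real.rpow_le_one_of_one_le_of_nonpos hX (by linarith)
    linarith
  obtain ⟨s, hs⟩ : ∃ s : ℕ, ⌈1 / (2 * ε)⌉₊ = s + 1 :=
    Nat.exists_eq_succ_of_ne_zero (Nat.ceil_pos.mpr (by positivity)).ne'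
  have hs1 : 1 / (2 * ε) ≤ s + 1 := by
    have := Nat.le_ceil (1 / (2 * ε))
    rw [hs] at this
    exact_mod_cast this
  have hs2 : (s : ℝ) + 1 < 1 / (2 * ε) + 1 := by
    have := Nat.ceil_lt_add_one (show 0 ≤ 1 / (2 * ε) by positivity)
    rw [hs] at this
    exact_mod_cast this
  have hs3 : 2 ≤ s := by
    have h1 : 2 < 1 / (2 * ε) := by
      rw [lt_div_iff₀ (by positivity)]
      linarith
    have h2 : (1 : ℝ) < s := by linarith
    exact_mod_cast h2
  set u : ℝ := 1 / (s + 1) with hu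
  have hs3' : (2 : ℝ) ≤ s := by exact_mod_cast hs3
  have hu0 : 0 < u := by positivity
  have hu3 : u ≤ 1 / 3 := one_div_le_one_div_of_le (by norm_num) (by linarith)
  have hu2 : u ≤ 2 * ε := by
    rw [hu, one_div_le (by positivity) (by positivity)]
    exact hs1
  have hu1 : 2 * ε ≤ u * (1 + 2 * ε) := by
    rw [hu, one_div_mul_eq_div, le_div_iff₀ (by positivity)]
    have h1 : 2 * ε * (1 / (2 * ε)) = 1 := by field_simp
    nlinarith
  obtain ⟨K, hK, hburgess⟩ := abs_shortCharSum_le_burgess s (by omega)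
    (show 0 < ε ^ 2 / 100 by positivity)
  have hα : ((s : ℝ) + 2) / (4 * (s + 1) ^ 2) = (u + u ^ 2) / 4 := by
    rw [hu]
    field_simp
    ring
  have hβ : -((s : ℝ) / (4 * (s + 1) ^ 2)) + ε ^ 2 / 100 = -((u - u ^ 2) / 4 - ε ^ 2 / 100) := by
    rw [hu]
    field_simp
    ring
  have hS : 0 ≤ ∑' n : ℕ, 1 / (n : ℝ) ^ (4 / 3 : ℝ) := tsum_nonneg fun n => by positivity
  set S := ∑' n : ℕ, 1 / (n : ℝ) ^ (4 / 3 : ℝ) with hSdef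
  refine ⟨42 * S * (1 + 8 * K) + 1, by positivity, fun σ hσ D hD X hX h p _ hp2 hp => ?_⟩
  have hX0 : 0 < X := by linarith
  have hp0 : (0 : ℝ) < p := by exact_mod_cast (Fact.out : p.Prime).pos
  have hpX := lt_rpow_of_lt_sqrt_mul_rpow (by exact_mod_cast hD) hX h hp
  suffices hgoal : ∃ θ c : ℝ, 0 ≤ c ∧ 0 ≤ θ ∧ θ ≤ 1 / 3 ∧
      (∀ (M : ZMod p) (N : ℕ), (N : ℝ) ≤ 7 * X →
        |shortCharSum p M N| ≤ c * (N : ℝ) ^ (1 - θ)) ∧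
      c * X ^ (1 - θ) ≤ (1 + 8 * K) * X ^ (1 - ε ^ 2) by
    obtain ⟨θ, c, hc, hθ0, hθ1, hE, hcX⟩ := hgoal
    calc _ ≤ 42 * S * (D.divisors.card : ℝ) * (c * X ^ (1 - θ)) :=
          abs_finsum_legendreSym_FSet_le hp2 hD.ne' hX hc hθ0 hθ1 hE
      _ ≤ 42 * S * (D.divisors.card : ℝ) * ((1 + 8 * K) * X ^ (1 - ε ^ 2)) := by gcongr
      _ = 42 * S * (1 + 8 * K) * (D.divisors.card : ℝ) * X ^ (1 - ε ^ 2) := by ring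
      _ ≤ _ := by
        gcongr
        linarith
  have hXε : 0 ≤ X ^ (1 - ε ^ 2) := by positivity
  rcases le_or_gt (p : ℝ) (X ^ (1 - 3 * ε ^ 2)) with hsmall | hlarge
  · refine ⟨1 / 3, (p : ℝ) ^ (1 / 3 : ℝ), by positivity, by norm_num, le_rfl,
      fun M N _ => abs_shortCharSum_le_rpow_third hp2 M N, ?_⟩
    refine (rpow_third_mul_le hX hp0.le hsmall).trans ?_
    nlinarith
  · have hε5 : ε ≤ 197 / 1000 := by
      have h1 : 1 - 3 * ε ^ 2 < 4 - 16 * ε := by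
        by_contra hcon
        exact absurd (hlarge.trans hpX) (not_lt.mpr
          (Real.rpow_le_rpow_of_exponent_le hX (not_lt.mp hcon)))
      nlinarith
    have hsave := saving_exponent_ge hε hε5 hu1 hu2
    have hβ0 : 0 ≤ (u - u ^ 2) / 4 - ε ^ 2 / 100 := by
      by_contra hcon
      have h1 : 0 < 1 - 3 * ε ^ 2 := by nlinarith
      nlinarith
    set β := (u - u ^ 2) / 4 - ε ^ 2 / 100 with hβdef
    set α := (u + u ^ 2) / 4 + ε ^ 2 / 100 with hαdef
    have hα0 : 0 ≤ α := by positivity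
    refine ⟨u, K * ((p : ℝ) ^ α + 7 * X ^ u * (p : ℝ) ^ (-β)), by positivity, hu0.le, hu3,
      fun M N hN => ?_, ?_⟩
    · have h1 := hburgess p hp2 M N
      rw [hβ, hα, ← hu, ← hαdef] at h1
      refine h1.trans ?_
      have h2 : (N : ℝ) ≤ 7 * X ^ u * (N : ℝ) ^ (1 - u) := by
        calc (N : ℝ) = (N : ℝ) ^ u * (N : ℝ) ^ (1 - u) := by
              rw [← Real.rpow_add' (Nat.cast_nonneg N) (by norm_num)]
              norm_num
          _ ≤ (7 * X) ^ u * (N : ℝ) ^ (1 - u) := by gcongr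
          _ = 7 ^ u * X ^ u * (N : ℝ) ^ (1 - u) := by rw [Real.mul_rpow (by norm_num) hX0.le]
          _ ≤ _ := by
            gcongr
            exact Real.rpow_le_self_of_one_le (by norm_num) (by linarith)
      rw [mul_assoc]
      gcongr
      calc _ ≤ (N : ℝ) ^ (1 - u) * (p : ℝ) ^ α +
            7 * X ^ u * (N : ℝ) ^ (1 - u) * (p : ℝ) ^ (-β) := by gcongr
        _ = _ := by ring
    · have h1 := burgess_factor_mul_le hX hα0 hβ0 hlarge hpX
        (main_exponent_le hε hε5 hu1 hu2) hsave
      rw [mul_assoc]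
      refine (mul_le_mul_of_nonneg_left h1 (by positivity)).trans ?_
      rw [add_mul]
      linarith
end

section
/- Fix a positive integer D. Then, as X → ∞, (1/(X*·log(√D·X)))·∑_{f ∈ F(X)} log(D·f²/π²) = 2 + log(16/(π²·e²))/log(√D·X) + O(1/(X^{1/2}·log X)), where e is Euler's number and the implied constant may depend on D. -/
open Filter Asymptotics

/-- `X* = #F(X)`. -/
noncomputable def Xstar (D : ℕ) (X : ℝ) : ℕ := (FSet D X).ncard

/-- The Iverson bracket of a proposition, as a real number. -/
noncomputable def iverson (p : Prop) : ℝ :=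
  open Classical in if p then 1 else 0

theorem iverson_of_not {p : Prop} (h : ¬p) : iverson p = 0 := if_neg h

open Finset in
theorem card_Ioc_filter_coprime_add_self (M K : ℕ) :
    #{m ∈ Ioc 0 (K + M) | M.Coprime m} = #{m ∈ Ioc 0 K | M.Coprime m} + M.totient := by
  rw [← Nat.filter_coprime_Ico_eq_totient M (K + 1), ← card_union_of_disjoint]
  · congr 1
    ext m
    simp only [mem_filter, mem_Ioc, mem_union, mem_Ico]
    grind
  · rw [disjoint_left]
    intro m
    simp only [mem_filter, mem_Ioc, mem_Ico]
    grind

open Finset in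
theorem abs_card_Ioc_filter_coprime_sub_le {M : ℕ} (hM : 0 < M) (K : ℕ) :
    |(#{m ∈ Ioc 0 K | M.Coprime m} : ℝ) - M.totient / M * K| ≤ M := by
  have hM' : (0 : ℝ) < M := by exact_mod_cast hM
  induction K using Nat.strong_induction_on with
  | _ K ih =>
    rcases lt_or_ge K M with h | h
    · have h1 : (#{m ∈ Ioc 0 K | M.Coprime m} : ℝ) ≤ K := by
        exact_mod_cast (card_filter_le _ _).trans (by simp)
      have h2 : (M.totient : ℝ) / M ≤ 1 := by
        rw [div_le_one hM']
        exact_mod_cast Nat.totient_le M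
      have h3 : (K : ℝ) ≤ M := by exact_mod_cast h.le
      have h4 : (0 : ℝ) ≤ M.totient / M := by positivity
      have h5 : (M.totient : ℝ) / M * K ≤ 1 * K := by gcongr
      have h6 : 0 ≤ (M.totient : ℝ) / M * K := by positivity
      rw [abs_le]
      constructor <;> linarith [(#{m ∈ Ioc 0 K | M.Coprime m}).cast_nonneg (α := ℝ)]
    · obtain ⟨k, rfl⟩ := Nat.exists_eq_add_of_le' h
      have := ih k (by omega)
      rw [card_Ioc_filter_coprime_add_self]
      push_cast
      convert this using 2
      field_simp
      ring

/-- The indicator function of the squarefree integers coprime to `M`. -/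
noncomputable def squarefreeCoprime (M n : ℕ) : ℝ :=
  iverson (Squarefree n ∧ M.Coprime n)

open Finset in
theorem sum_filter_sq_dvd_moebius {n s : ℕ} (hn : 0 < n) (hs : n < (s + 1) ^ 2) :
    (∑ d ∈ Ioc 0 s with d ^ 2 ∣ n, (ArithmeticFunction.moebius d : ℝ)) =
      iverson (Squarefree n) := by
  obtain ⟨a, b, ha, hb, rfl, hsq⟩ := Nat.sq_mul_squarefree_of_pos hn
  have hdvd (d : ℕ) : d ^ 2 ∣ b ^ 2 * a ↔ d ∣ b := by
    refine ⟨fun h => ?_, fun h => (pow_dvd_pow_of_dvd h 2).mul_right a⟩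
    obtain ⟨g, d', b', hg, hcop, rfl, rfl⟩ := Nat.exists_coprime' (m := d) (n := b)
      (Nat.gcd_pos_of_pos_right _ hb)
    rw [mul_pow, mul_pow, mul_right_comm, Nat.mul_dvd_mul_iff_right (by positivity)] at h
    have h1 : d' * d' ∣ a := by
      rw [← sq]
      exact (hcop.pow 2 2).dvd_of_dvd_mul_left h
    rw [Nat.isUnit_iff.1 (hsq d' h1), one_mul]
    exact dvd_mul_left g b'
  have hfil : {d ∈ Ioc 0 s | d ^ 2 ∣ b ^ 2 * a} = b.divisors := by
    ext d
    simp only [mem_filter, mem_Ioc, hdvd, Nat.mem_divisors]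
    refine ⟨fun h => ⟨h.2, hb.ne'⟩, fun h => ⟨⟨Nat.pos_of_dvd_of_pos h.1 hb, ?_⟩, h.1⟩⟩
    have h1 := Nat.le_of_dvd hb h.1
    have h2 : b ^ 2 ≤ b ^ 2 * a := Nat.le_mul_of_pos_right _ ha
    have : d < s + 1 := by
      apply lt_of_pow_lt_pow_left₀ 2 (by omega)
      calc d ^ 2 ≤ b ^ 2 := by gcongr
        _ < _ := h2.trans_lt hs
    omega
  have hsqf : Squarefree (b ^ 2 * a) ↔ b = 1 := by
    refine ⟨fun h => ?_, fun h => by simpa [h] using hsq⟩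
    exact Nat.isUnit_iff.1 (h b ⟨a, by ring⟩)
  have := congrArg (fun f => f b) ArithmeticFunction.moebius_mul_coe_zeta
  simp only [ArithmeticFunction.coe_mul_zeta_apply, ArithmeticFunction.one_apply] at this
  rw [hfil, ← Int.cast_sum, this]
  simp [iverson, hsqf]

open Finset in
theorem sum_squarefreeCoprime_eq (M N : ℕ) :
    ∑ n ∈ Ioc 0 N, squarefreeCoprime M n =
      ∑ d ∈ Ioc 0 N.sqrt with M.Coprime d, (ArithmeticFunction.moebius d : ℝ) *
        #{m ∈ Ioc 0 (N / d ^ 2) | M.Coprime m} := by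
  classical
  have h1 : ∀ n ∈ Ioc 0 N, squarefreeCoprime M n =
      ∑ d ∈ Ioc 0 N.sqrt, if d ^ 2 ∣ n ∧ M.Coprime n then
        (ArithmeticFunction.moebius d : ℝ) else 0 := by
    intro n hn
    rw [mem_Ioc] at hn
    have := sum_filter_sq_dvd_moebius (s := N.sqrt) hn.1
      (hn.2.trans_lt (by simpa [sq] using Nat.lt_succ_sqrt N))
    rw [sum_filter] at this
    by_cases hc : M.Coprime n 
    · rw [squarefreeCoprime, and_iff_left hc, ← this]
      exact sum_congr rfl fun d _ => if_congr (and_iff_left hc).symm rfl rfl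
    · simp [squarefreeCoprime, iverson, hc]
  rw [sum_congr rfl h1, sum_comm, sum_filter]
  refine sum_congr rfl fun d hd => ?_
  rw [mem_Ioc] at hd
  rw [← sum_filter, sum_const, nsmul_eq_mul, mul_comm]
  split_ifs with hc
  · congr 2
    refine (card_bij (fun m _ => d ^ 2 * m) ?_ ?_ ?_).symm
    · intro m hm
      simp only [mem_filter, mem_Ioc] at hm ⊢
      have : 0 < d ^ 2 := by have := hd.1; positivity
      refine ⟨⟨by have := hm.1.1; positivity, ?_⟩, dvd_mul_right _ _, ?_⟩
      · rw [mul_comm]; exact (Nat.le_div_iff_mul_le this).1 hm.1.2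
      · exact (hc.pow_right 2).mul_right hm.2
    · intro m _ m' _ h
      exact Nat.eq_of_mul_eq_mul_left (by have := hd.1; positivity) h
    · intro n hn
      simp only [mem_filter, mem_Ioc] at hn
      obtain ⟨⟨h0, hN⟩, ⟨m, rfl⟩, hcop⟩ := hn
      refine ⟨m, ?_, rfl⟩
      simp only [mem_filter, mem_Ioc]
      refine ⟨⟨Nat.pos_of_mul_pos_left h0, ?_⟩, hcop.coprime_mul_left_right⟩
      rw [Nat.le_div_iff_mul_le (by have := hd.1; positivity), mul_comm]
      exact hN
  · convert mul_zero _
    norm_cast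
    rw [card_eq_zero, filter_eq_empty_iff]
    intro n _ hn
    exact hc ((hn.2.coprime_dvd_right hn.1).coprime_dvd_right (dvd_pow_self d two_ne_zero))

open Finset in
theorem abs_tsum_sub_sum_Ioc_le {w : ℕ → ℝ} (hw : ∀ d, |w d| ≤ ((d : ℝ) ^ 2)⁻¹)
    {s : ℕ} (hs : s ≠ 0) : |∑' d, w d - ∑ d ∈ Ioc 0 s, w d| ≤ (s : ℝ)⁻¹ := by
  have hsum : Summable w := by
    refine Summable.of_norm_bounded (Real.summable_nat_pow_inv.2 one_lt_two) ?_
    simpa using hw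
  have h0 : w 0 = 0 := by simpa using hw 0
  have hlim : Filter.Tendsto (fun n : ℕ => |∑ d ∈ range (n + 1), w d - ∑ d ∈ Ioc 0 s, w d|)
      Filter.atTop (nhds |∑' d, w d - ∑ d ∈ Ioc 0 s, w d|) :=
    (((Filter.tendsto_add_atTop_iff_nat 1).2 hsum.hasSum.tendsto_sum_nat).sub_const _).abs
  refine le_of_tendsto hlim ?_
  filter_upwards [Filter.eventually_ge_atTop s] with n hn
  have h1 : ∑ d ∈ range (n + 1), w d = ∑ d ∈ Ioc 0 n, w d := by
    rw [range_eq_Ico, sum_eq_sum_Ico_succ_bot (by omega), h0, zero_add]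
    rfl
  rw [h1, ← sum_Ioc_consecutive w (Nat.zero_le s) hn, add_sub_cancel_left]
  calc |∑ d ∈ Ioc s n, w d| ≤ ∑ d ∈ Ioc s n, ((d : ℝ) ^ 2)⁻¹ :=
        (abs_sum_le_sum_abs _ _).trans (sum_le_sum fun d _ => hw d)
    _ ≤ (s : ℝ)⁻¹ - (n : ℝ)⁻¹ := sum_Ioc_inv_sq_le_sub hs hn
    _ ≤ (s : ℝ)⁻¹ := by linarith [inv_nonneg.2 (Nat.cast_nonneg (α := ℝ) n)]

open Finset in
theorem exists_abs_sum_squarefreeCoprime_sub_le {M : ℕ} (hM : 0 < M) :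
    ∃ c > 0, ∃ K ≥ 0, ∀ N : ℕ,
      |∑ n ∈ Ioc 0 N, squarefreeCoprime M n - c * N| ≤ K * √N := by
  set w : ℕ → ℝ := fun d =>
    if M.Coprime d then (ArithmeticFunction.moebius d : ℝ) * ((d : ℝ) ^ 2)⁻¹ else 0 with hw_def
  have hmu (d : ℕ) : |(ArithmeticFunction.moebius d : ℝ)| ≤ 1 := by
    exact_mod_cast ArithmeticFunction.abs_moebius_le_one (n := d)
  have hw (d : ℕ) : |w d| ≤ ((d : ℝ) ^ 2)⁻¹ := by
    simp only [hw_def]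
    split_ifs
    · rw [abs_mul, abs_of_nonneg (a := ((d : ℝ) ^ 2)⁻¹) (by positivity)]
      exact mul_le_of_le_one_left (by positivity) (hmu d)
    · simp only [abs_zero]; positivity
  have hpos : 0 < ∑' d, w d := by
    have h1 := abs_le.1 (abs_tsum_sub_sum_Ioc_le hw two_ne_zero)
    have h2 := abs_le.1 (hw 2)
    have h3 : w 1 = 1 := by simp [hw_def]
    have h4 : ∑ d ∈ Ioc 0 2, w d = w 1 + w 2 := by
      simp [sum_Ioc_succ_top]
    rw [h4, h3] at h1
    norm_num at h1 h2
    linarith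
  set δ : ℝ := M.totient / M with hδ
  have hM' : (0 : ℝ) < M := by exact_mod_cast hM
  have hδ0 : 0 < δ := div_pos (by exact_mod_cast Nat.totient_pos.2 hM) hM'
  have hδ1 : δ ≤ 1 := by
    rw [hδ, div_le_one hM']
    exact_mod_cast Nat.totient_le M
  refine ⟨δ * ∑' d, w d, by positivity, M + 1 + 4, by positivity, fun N => ?_⟩
  rcases Nat.eq_zero_or_pos N with rfl | hN
  · simp
  set s := N.sqrt with hs
  have hs0 : 0 < s := Nat.sqrt_pos.2 hN
  have hs0' : (1 : ℝ) ≤ s := by exact_mod_cast hs0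
  have hs1 : (s : ℝ) ≤ √N := Real.nat_sqrt_le_real_sqrt
  have hs2 : (N : ℝ) ≤ 4 * s ^ 2 := by
    have : N < (s + 1) ^ 2 := by simpa [sq] using Nat.lt_succ_sqrt N
    have : (N : ℝ) < (s + 1) ^ 2 := by exact_mod_cast this
    nlinarith
  have hmain : |∑ n ∈ Ioc 0 N, squarefreeCoprime M n - δ * N * ∑ d ∈ Ioc 0 s, w d| ≤
      (M + 1) * s := by
    rw [sum_squarefreeCoprime_eq, sum_filter, mul_sum, ← sum_sub_distrib]
    refine (abs_sum_le_sum_abs _ _).trans ((sum_le_card_nsmul _ _ (M + 1 : ℝ) ?_).trans ?_)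
    · intro d hd
      rw [mem_Ioc] at hd
      simp only [hw_def]
      split_ifs
      · have h1 := abs_card_Ioc_filter_coprime_sub_le hM (N / d ^ 2)
        have hd2 : (0 : ℝ) < (d : ℝ) ^ 2 := by
          have : (0 : ℝ) < d := by exact_mod_cast hd.1
          positivity
        have h2 : |δ * (N / d ^ 2 : ℕ) - δ * (N / (d : ℝ) ^ 2)| ≤ 1 := by
          rw [← mul_sub, abs_mul, abs_of_pos hδ0]
          refine mul_le_one₀ hδ1 (abs_nonneg _) ?_
          have h3 : ((N / d ^ 2 : ℕ) : ℝ) ≤ N / (d : ℝ) ^ 2 := by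
            exact_mod_cast Nat.cast_div_le (m := N) (n := d ^ 2) (α := ℝ)
          have h4 : N / (d : ℝ) ^ 2 < ((N / d ^ 2 : ℕ) : ℝ) + 1 := by
            rw [div_lt_iff₀ hd2]
            rw [mul_comm]
            exact_mod_cast Nat.lt_mul_div_succ N (show 0 < d ^ 2 by exact_mod_cast hd2)
          rw [abs_le]; constructor <;> linarith
        rw [show δ * N * ((ArithmeticFunction.moebius d : ℝ) * ((d : ℝ) ^ 2)⁻¹) =
          (ArithmeticFunction.moebius d : ℝ) * (δ * (N / (d : ℝ) ^ 2)) by ring, ← mul_sub, abs_mul]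
        refine (mul_le_of_le_one_left (abs_nonneg _) (hmu d)).trans ?_
        exact (abs_sub_le _ _ _).trans (add_le_add h1 h2)
      · simp; positivity
    · rw [Nat.card_Ioc, nsmul_eq_mul, Nat.sub_zero, mul_comm]
  have htail : |δ * N * ∑ d ∈ Ioc 0 s, w d - δ * (∑' d, w d) * N| ≤ 4 * s := by
    rw [show δ * N * ∑ d ∈ Ioc 0 s, w d - δ * (∑' d, w d) * N =
      -(δ * (N * (∑' d, w d - ∑ d ∈ Ioc 0 s, w d))) by ring, abs_neg, abs_mul, abs_of_pos hδ0]
    refine (mul_le_of_le_one_left (abs_nonneg _) hδ1).trans ?_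
    rw [abs_mul, abs_of_nonneg (Nat.cast_nonneg _)]
    calc (N : ℝ) * _ ≤ 4 * s ^ 2 * (s : ℝ)⁻¹ := by
          gcongr
          exact abs_tsum_sub_sum_Ioc_le hw hs0.ne'
      _ = 4 * s := by field_simp
  calc _ ≤ _ := abs_sub_le _ (δ * N * ∑ d ∈ Ioc 0 s, w d) _
    _ ≤ (M + 1) * s + 4 * s := add_le_add hmain htail
    _ = (M + 1 + 4) * s := by ring
    _ ≤ _ := by gcongr

open Finset in
theorem sum_Ioc_ite_dvd (g : ℕ → ℝ) {k : ℕ} (hk : 0 < k) (N : ℕ) :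
    ∑ n ∈ Ioc 0 N, (if k ∣ n then g (n / k) else 0) = ∑ m ∈ Ioc 0 (N / k), g m := by
  rw [← sum_filter]
  refine (sum_bij (fun m _ => k * m) ?_ ?_ ?_ ?_).symm
  · intro m hm
    simp only [mem_filter, mem_Ioc] at hm ⊢
    refine ⟨⟨by have := hm.1; positivity, ?_⟩, dvd_mul_right _ _⟩
    rw [mul_comm]; exact (Nat.le_div_iff_mul_le hk).1 hm.2
  · intro m _ m' _ h
    exact Nat.eq_of_mul_eq_mul_left hk h
  · intro n hn
    simp only [mem_filter, mem_Ioc] at hn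
    obtain ⟨⟨h0, hN⟩, ⟨m, rfl⟩⟩ := hn
    refine ⟨m, ?_, rfl⟩
    rw [mem_Ioc, Nat.le_div_iff_mul_le hk, mul_comm m]
    exact ⟨Nat.pos_of_mul_pos_left h0, hN⟩
  · intro m _
    rw [Nat.mul_div_cancel_left _ hk]

/-- The number of fundamental discriminants `f` coprime to `D` with `|f| = n`, for `n > 0`. -/
noncomputable def discriminantWeight (D n : ℕ) : ℝ :=
  squarefreeCoprime (2 * D) n +
    if Odd D then
      (if 4 ∣ n then squarefreeCoprime (2 * D) (n / 4) else 0) +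
        2 * (if 8 ∣ n then squarefreeCoprime (2 * D) (n / 8) else 0)
    else 0

theorem squarefreeCoprime_nonneg (M n : ℕ) : 0 ≤ squarefreeCoprime M n := by
  unfold squarefreeCoprime iverson; split_ifs <;> norm_num

theorem squarefreeCoprime_le_one (M n : ℕ) : squarefreeCoprime M n ≤ 1 := by
  unfold squarefreeCoprime iverson; split_ifs <;> norm_num

theorem abs_discriminantWeight_le (D n : ℕ) : |discriminantWeight D n| ≤ 4 := by
  have h (m : ℕ) := squarefreeCoprime_nonneg (2 * D) m
  have h' (m : ℕ) := squarefreeCoprime_le_one (2 * D) m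
  unfold discriminantWeight
  rw [abs_le]
  split_ifs <;> constructor <;> linarith [h n, h (n / 4), h (n / 8), h' n, h' (n / 4), h' (n / 8)]

theorem discriminantWeight_zero (D : ℕ) : discriminantWeight D 0 = 0 := by
  simp [discriminantWeight, squarefreeCoprime, iverson]

open Finset in
theorem exists_abs_sum_squarefreeCoprime_floor_sub_le {M : ℕ} (hM : 0 < M) :
    ∃ c > 0, ∃ K ≥ 0, ∀ k : ℕ, 0 < k → ∀ t : ℝ, 1 ≤ t →
      |∑ n ∈ Ioc 0 (⌊t⌋₊ / k), squarefreeCoprime M n - c * (t / k)| ≤ K * √t := by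
  obtain ⟨c, hc, K, hK, h⟩ := exists_abs_sum_squarefreeCoprime_sub_le hM
  refine ⟨c, hc, K + c, by positivity, fun k hk t ht => ?_⟩
  have hk' : (1 : ℝ) ≤ k := by exact_mod_cast hk
  rw [← Nat.floor_div_natCast]
  have h0 : 0 ≤ t / k := by positivity
  have h1 := Nat.floor_le h0
  have h2 := Nat.lt_floor_add_one (t / k)
  have h3 : √(⌊t / k⌋₊ : ℝ) ≤ √t := Real.sqrt_le_sqrt (h1.trans (div_le_self (by linarith) hk'))
  have h4 : 1 ≤ √t := Real.one_le_sqrt.2 ht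
  have h5 : |c * (⌊t / k⌋₊ : ℝ) - c * (t / k)| ≤ c * 1 := by
    rw [← mul_sub, abs_mul, abs_of_pos hc]
    gcongr
    rw [abs_le]; constructor <;> linarith
  calc _ ≤ _ := abs_sub_le _ (c * (⌊t / k⌋₊ : ℝ)) _
    _ ≤ K * √(⌊t / k⌋₊ : ℝ) + c * 1 := add_le_add (h _) h5
    _ ≤ K * √t + c * √t := by gcongr
    _ = _ := by ring

open Finset in
theorem exists_abs_sum_discriminantWeight_sub_le {D : ℕ} (hD : 0 < D) :
    ∃ c > 0, ∃ K ≥ 0, ∀ t : ℝ, 1 ≤ t →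
      |∑ n ∈ Icc 0 ⌊t⌋₊, discriminantWeight D n - c * t| ≤ K * √t := by
  obtain ⟨c, hc, K, hK, h⟩ := exists_abs_sum_squarefreeCoprime_floor_sub_le
    (M := 2 * D) (by positivity)
  have hIcc (N : ℕ) : ∑ n ∈ Icc 0 N, discriminantWeight D n =
      ∑ n ∈ Ioc 0 N, discriminantWeight D n := by
    rw [← add_sum_Ioc_eq_sum_Icc (Nat.zero_le N), discriminantWeight_zero, zero_add]
  simp only [hIcc]
  simp only [discriminantWeight]
  by_cases hodd : Odd D
  · refine ⟨c * (3 / 2), by positivity, 4 * K, by positivity, fun t ht => ?_⟩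
    simp only [if_pos hodd, sum_add_distrib, ← mul_sum, sum_Ioc_ite_dvd _ (show 0 < 4 by norm_num),
      sum_Ioc_ite_dvd _ (show 0 < 8 by norm_num)]
    have h1 := abs_le.1 (h 1 one_pos t ht)
    have h4 := abs_le.1 (h 4 (by norm_num) t ht)
    have h8 := abs_le.1 (h 8 (by norm_num) t ht)
    rw [Nat.div_one] at h1
    push_cast at h1 h4 h8
    rw [abs_le]
    constructor <;> linarith
  · refine ⟨c, hc, K, hK, fun t ht => ?_⟩
    simpa [if_neg hodd] using h 1 one_pos t ht

theorem isFundamentalDiscriminant_of_odd {f : ℤ} (hf : f % 2 = 1) :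
    IsFundamentalDiscriminant f ↔ f % 4 = 1 ∧ Squarefree f := by
  unfold IsFundamentalDiscriminant
  refine or_iff_left ?_
  rintro ⟨m, rfl, -⟩
  omega

theorem isFundamentalDiscriminant_four_mul (m : ℤ) :
    IsFundamentalDiscriminant (4 * m) ↔ Squarefree m ∧ (m % 4 = 2 ∨ m % 4 = 3) := by
  unfold IsFundamentalDiscriminant
  constructor
  · rintro (⟨h, -⟩ | ⟨m', h, h'⟩)
    · omega
    · rwa [show m = m' by omega]
  · exact fun h => Or.inr ⟨m, rfl, h⟩

theorem squarefree_neg_intCast (n : ℕ) : Squarefree (-(n : ℤ)) ↔ Squarefree n := by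
  rw [← Int.squarefree_natAbs]; simp

theorem isCoprime_neg_natCast (n D : ℕ) : IsCoprime (-(n : ℤ)) D ↔ D.Coprime n := by
  rw [IsCoprime.neg_left_iff, Nat.isCoprime_iff_coprime, Nat.coprime_comm]

theorem squarefreeCoprime_two_mul_of_even {D n : ℕ} (hn : n % 2 = 0) :
    squarefreeCoprime (2 * D) n = 0 := by
  refine iverson_of_not fun h => ?_
  have h2 : Nat.Coprime 2 n := h.2.coprime_mul_right
  rw [Nat.coprime_two_left, Nat.odd_iff] at h2
  omega

theorem squarefreeCoprime_two_mul_of_odd {D n : ℕ} (hn : n % 2 = 1) :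
    squarefreeCoprime (2 * D) n = iverson (Squarefree n ∧ D.Coprime n) := by
  have : Nat.Coprime 2 n := by rwa [Nat.coprime_two_left, Nat.odd_iff]
  unfold squarefreeCoprime
  congr 1
  refine propext (and_congr_right fun _ => ?_)
  rw [Nat.coprime_mul_iff_left]
  exact and_iff_right this

theorem iverson_add_iverson_eq_discriminantWeight {D n : ℕ} (hn : 0 < n) :
    iverson (IsFundamentalDiscriminant n ∧ IsCoprime (n : ℤ) D) +
      iverson (IsFundamentalDiscriminant (-n) ∧ IsCoprime (-n : ℤ) D) =
      discriminantWeight D n := by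
  have hcop (n : ℕ) : IsCoprime (n : ℤ) D ↔ D.Coprime n := by
    rw [Nat.isCoprime_iff_coprime, Nat.coprime_comm]
  rw [isCoprime_neg_natCast, hcop]
  unfold discriminantWeight
  rcases Nat.mod_two_eq_zero_or_one n with h2 | h2
  swap
  · rw [isFundamentalDiscriminant_of_odd (by omega), isFundamentalDiscriminant_of_odd (by omega),
      squarefree_neg_intCast, Int.squarefree_natCast, if_neg (show ¬ 4 ∣ n by omega),
      if_neg (show ¬ 8 ∣ n by omega), squarefreeCoprime_two_mul_of_odd h2]
    rcases (by omega : n % 4 = 1 ∨ n % 4 = 3) with h4 | h4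
    · simp [iverson, show (n : ℤ) % 4 = 1 by omega, show ¬ (-(n : ℤ)) % 4 = 1 by omega]
    · simp [iverson, show ¬ (n : ℤ) % 4 = 1 by omega, show (-(n : ℤ)) % 4 = 1 by omega]
  rw [squarefreeCoprime_two_mul_of_even h2]
  by_cases h4 : 4 ∣ n
  swap
  · rw [if_neg h4, if_neg (show ¬ 8 ∣ n by omega), iverson_of_not, iverson_of_not]
    · simp
    · rintro ⟨h | ⟨m, h, -⟩, -⟩ <;> omega
    · rintro ⟨h | ⟨m, h, -⟩, -⟩ <;> omega
  obtain ⟨m, rfl⟩ := h4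
  have e1 : ((4 * m : ℕ) : ℤ) = 4 * (m : ℤ) := by push_cast; rfl
  have e2 : -((4 * m : ℕ) : ℤ) = 4 * (-(m : ℤ)) := by push_cast; ring
  rw [e2, e1, isFundamentalDiscriminant_four_mul, isFundamentalDiscriminant_four_mul,
    squarefree_neg_intCast, Int.squarefree_natCast]
  by_cases hodd : Odd D
  swap
  · have : ¬ D.Coprime (4 * m) := by
      intro h
      have := h.coprime_dvd_right (show 2 ∣ 4 * m by omega)
      rw [Nat.coprime_two_right] at this
      exact hodd this
    simp [iverson, hodd, this]
  have hc : D.Coprime (4 * m) ↔ D.Coprime m := by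
    have : D.Coprime 4 := (Nat.coprime_two_right.2 hodd).pow_right 2
    rw [Nat.coprime_mul_iff_right]
    exact and_iff_right this
  rw [if_pos hodd, if_pos (dvd_mul_right 4 m), Nat.mul_div_cancel_left _ (by norm_num), hc]
  rcases Nat.mod_two_eq_zero_or_one m with hm | hm
  swap
  · rw [if_neg (show ¬ 8 ∣ 4 * m by omega), squarefreeCoprime_two_mul_of_odd hm]
    rcases (by omega : m % 4 = 1 ∨ m % 4 = 3) with h4 | h4
    · simp [iverson, show (m : ℤ) % 4 = 1 by omega, show (-(m : ℤ)) % 4 = 3 by omega]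
    · simp [iverson, show (m : ℤ) % 4 = 3 by omega, show (-(m : ℤ)) % 4 = 1 by omega]
  obtain ⟨k, rfl⟩ := Nat.dvd_of_mod_eq_zero hm
  rw [if_pos (show 8 ∣ 4 * (2 * k) by omega), squarefreeCoprime_two_mul_of_even hm,
    show 4 * (2 * k) / 8 = k by omega]
  rcases Nat.mod_two_eq_zero_or_one k with hk | hk
  · rw [squarefreeCoprime_two_mul_of_even hk, iverson_of_not, iverson_of_not]
    · simp
    · rintro ⟨⟨-, h⟩, -⟩; omega
    · rintro ⟨⟨-, h⟩, -⟩; omega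
  · have hk2 : Nat.Coprime 2 k := by rwa [Nat.coprime_two_left, Nat.odd_iff]
    have hsq : Squarefree (2 * k) ↔ Squarefree k := by
      rw [Nat.squarefree_mul hk2]
      exact and_iff_right Nat.prime_two.squarefree
    have hc2 : D.Coprime (2 * k) ↔ D.Coprime k := by
      rw [Nat.coprime_mul_iff_right]
      exact and_iff_right (Nat.coprime_two_right.2 hodd)
    rw [squarefreeCoprime_two_mul_of_odd hk, hsq, hc2,
      and_iff_left (Or.inl (show ((2 * k : ℕ) : ℤ) % 4 = 2 by omega)),
      and_iff_left (Or.inl (show (-((2 * k : ℕ) : ℤ)) % 4 = 2 by omega))]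
    ring

theorem finite_FSet (D : ℕ) (X : ℝ) : (FSet D X).Finite := by
  refine (Set.finite_Icc (-⌈2 * X⌉) ⌈2 * X⌉).subset fun f hf => ?_
  have h : ((|f| : ℤ) : ℝ) < ⌈2 * X⌉ := by
    push_cast
    exact hf.2.2.2.trans_le (Int.le_ceil _)
  exact abs_le.1 (Int.cast_lt.1 h).le

open Finset in
theorem finsum_mem_FSet_eq (D : ℕ) {X : ℝ} (hX : 0 < X) {h : ℤ → ℝ} (heven : ∀ f, h (-f) = h f) :
    ∑ᶠ f ∈ FSet D X, h f = ∑ n ∈ Ico ⌈X⌉₊ ⌈2 * X⌉₊, h n * discriminantWeight D n := by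
  classical
  set P : ℤ → Prop := fun f => IsFundamentalDiscriminant f ∧ IsCoprime f (D : ℤ) with hP
  set s : Finset ℤ := {n ∈ Ico ⌈X⌉₊ ⌈2 * X⌉₊ | P ((n : ℕ) : ℤ)}.image fun n : ℕ => (n : ℤ)
  set t : Finset ℤ := {n ∈ Ico ⌈X⌉₊ ⌈2 * X⌉₊ | P (-((n : ℕ) : ℤ))}.image fun n : ℕ => -(n : ℤ)
  have hpos : ∀ n ∈ Ico ⌈X⌉₊ ⌈2 * X⌉₊, 0 < n := fun n hn =>
    (Nat.ceil_pos.2 hX).trans_le (mem_Ico.1 hn).1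
  have hmem (n : ℕ) : n ∈ Ico ⌈X⌉₊ ⌈2 * X⌉₊ ↔ X ≤ n ∧ (n : ℝ) < 2 * X := by
    rw [mem_Ico, Nat.ceil_le, Nat.lt_ceil]
  have hset : FSet D X = ((s ∪ t : Finset ℤ) : Set ℤ) := by
    ext f
    simp only [FSet, s, t, Set.mem_ofPred_eq, coe_union, coe_image, Set.mem_union, Set.mem_image,
      mem_coe, mem_filter, hmem]
    constructor
    · rintro ⟨h1, h2, h3, h4⟩
      rcases Int.eq_nat_or_neg f with ⟨n, rfl | rfl⟩
      · rw [Int.cast_natCast, Nat.abs_cast] at h3 h4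
        exact Or.inl ⟨n, ⟨⟨h3, h4⟩, h1, h2⟩, rfl⟩
      · rw [Int.cast_neg, abs_neg, Int.cast_natCast, Nat.abs_cast] at h3 h4
        exact Or.inr ⟨n, ⟨⟨h3, h4⟩, h1, h2⟩, rfl⟩
    · rintro (⟨n, ⟨⟨h3, h4⟩, h1, h2⟩, rfl⟩ | ⟨n, ⟨⟨h3, h4⟩, h1, h2⟩, rfl⟩)
      · refine ⟨h1, h2, ?_⟩
        rw [Int.cast_natCast, Nat.abs_cast]
        exact ⟨h3, h4⟩
      · refine ⟨h1, h2, ?_⟩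
        rw [Int.cast_neg, abs_neg, Int.cast_natCast, Nat.abs_cast]
        exact ⟨h3, h4⟩
  have hdisj : Disjoint s t := by
    rw [disjoint_left]
    intro f hs ht
    simp only [s, t, mem_image, mem_filter] at hs ht
    obtain ⟨n, ⟨hn, -⟩, rfl⟩ := hs
    obtain ⟨m, ⟨hm, -⟩, h⟩ := ht
    have := hpos n hn
    omega
  rw [hset, finsum_mem_coe_finset, sum_union hdisj, sum_image (fun _ _ _ _ h => by simpa using h),
    sum_image (fun _ _ _ _ h => by simpa using h), sum_filter, sum_filter, ← sum_add_distrib]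
  refine sum_congr rfl fun n hn => ?_
  rw [← iverson_add_iverson_eq_discriminantWeight (hpos n hn), heven, mul_add, iverson, iverson]
  simp [hP]

open Finset in
theorem abs_sum_range_ceil_sub_sum_range_floor_le {g : ℕ → ℝ} {x B : ℝ} (hx : 0 ≤ x) (hB : 0 ≤ B)
    (hg : ∀ n : ℕ, (n : ℝ) = x → |g n| ≤ B) :
    |∑ n ∈ range ⌈x⌉₊, g n - ∑ n ∈ range (⌊x⌋₊ + 1), g n| ≤ B := by
  rcases (Nat.ceil_le_floor_add_one x).eq_or_lt with h | h
  · simpa [h] using hB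
  · have h1 : ⌈x⌉₊ = ⌊x⌋₊ := le_antisymm (Nat.lt_succ_iff.1 h) (Nat.floor_le_ceil x)
    have h2 : (⌊x⌋₊ : ℝ) = x := le_antisymm (Nat.floor_le hx) (h1 ▸ Nat.le_ceil x)
    rw [h1, sum_range_succ, sub_add_cancel_left, abs_neg]
    exact hg _ h2

open Finset in
theorem abs_sum_Ico_ceil_sub_sum_Ioc_floor_le {g : ℕ → ℝ} {x y B : ℝ} (hx : 0 ≤ x) (hxy : x ≤ y)
    (hB : 0 ≤ B) (hg : ∀ n : ℕ, x ≤ n → (n : ℝ) ≤ y → |g n| ≤ B) :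
    |∑ n ∈ Ico ⌈x⌉₊ ⌈y⌉₊, g n - ∑ n ∈ Ioc ⌊x⌋₊ ⌊y⌋₊, g n| ≤ 2 * B := by
  have h1 := abs_le.1 (abs_sum_range_ceil_sub_sum_range_floor_le (g := g) hx hB
    fun n hn => hg n hn.ge (hn.trans_le hxy))
  have h2 := abs_le.1 (abs_sum_range_ceil_sub_sum_range_floor_le (g := g) (hx.trans hxy) hB
    fun n hn => hg n (hxy.trans hn.ge) hn.le)
  have h3 : ∑ n ∈ Ioc ⌊x⌋₊ ⌊y⌋₊, g n =
      ∑ n ∈ range (⌊y⌋₊ + 1), g n - ∑ n ∈ range (⌊x⌋₊ + 1), g n := by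
    rw [← sum_Ico_eq_sub _ (Nat.add_le_add_right (Nat.floor_le_floor hxy) 1), Ico_add_one_add_one_eq_Ioc]
  rw [sum_Ico_eq_sub _ (Nat.ceil_le_ceil hxy), h3, abs_le]
  constructor <;> linarith

theorem sqrt_two_mul_le {x : ℝ} (hx : 0 ≤ x) : √(2 * x) ≤ 2 * √x := by
  rw [Real.sqrt_le_left (by positivity), mul_pow, Real.sq_sqrt hx]
  linarith

section Dyadic

variable {a : ℕ → ℝ} {B c K X : ℝ}

open Finset in
theorem abs_sum_dyadic_sub_le (ha : ∀ n, |a n| ≤ B) (hK : 0 ≤ K)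
    (hA : ∀ t : ℝ, 1 ≤ t → |∑ n ∈ Icc 0 ⌊t⌋₊, a n - c * t| ≤ K * √t) (hX : 1 ≤ X) :
    |∑ n ∈ Ico ⌈X⌉₊ ⌈2 * X⌉₊, a n - c * X| ≤ (5 * K + 2 * B) * √X := by
  have hB : 0 ≤ B := (abs_nonneg _).trans (ha 0)
  have h1 := abs_le.1 (abs_sum_Ico_ceil_sub_sum_Ioc_floor_le (g := a) (x := X) (y := 2 * X)
    (by linarith) (by linarith) hB fun n _ _ => ha n)
  have h2 := abs_le.1 (hA X hX)
  have h3 := abs_le.1 (hA (2 * X) (by linarith))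
  have h4 : ∑ n ∈ Ioc ⌊X⌋₊ ⌊2 * X⌋₊, a n =
      ∑ n ∈ Icc 0 ⌊2 * X⌋₊, a n - ∑ n ∈ Icc 0 ⌊X⌋₊, a n := by
    have : ⌊X⌋₊ ≤ ⌊2 * X⌋₊ := Nat.floor_le_floor (by linarith)
    rw [← Nat.range_succ_eq_Icc_zero, ← Nat.range_succ_eq_Icc_zero,
      ← sum_Ico_eq_sub _ (Nat.add_le_add_right this 1), Ico_add_one_add_one_eq_Ioc]
  have h5 := sqrt_two_mul_le (zero_le_one.trans hX)
  have h6 : 1 ≤ √X := Real.one_le_sqrt.2 hX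
  have h7 := mul_le_mul_of_nonneg_left h5 hK
  have h8 := mul_le_mul_of_nonneg_left h6 hB
  have h9 : 0 ≤ K * √X := by positivity
  rw [abs_le]
  constructor <;> linarith

open Finset MeasureTheory in
/-- The mean of `log n` over `X ≤ n < 2 X` weighted by a sequence of positive density is
`log X + 2 log 2 - 1`. -/
theorem abs_sum_dyadic_log_sub_le (ha : ∀ n, |a n| ≤ B) (hK : 0 ≤ K)
    (hA : ∀ t : ℝ, 1 ≤ t → |∑ n ∈ Icc 0 ⌊t⌋₊, a n - c * t| ≤ K * √t) (hX : 1 ≤ X) :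
    |∑ n ∈ Ico ⌈X⌉₊ ⌈2 * X⌉₊, (Real.log n - (Real.log X + (2 * Real.log 2 - 1))) * a n| ≤
      (5 * K + 2 * B) * √X := by
  have hX0 : 0 < X := by linarith
  have hB : 0 ≤ B := (abs_nonneg _).trans (ha 0)
  have hl1 := Real.log_two_gt_d9
  have hl2 := Real.log_two_lt_d9
  have hlog : Real.log (2 * X) = Real.log 2 + Real.log X :=
    Real.log_mul two_ne_zero hX0.ne'
  set f : ℝ → ℝ := fun t => Real.log t - (Real.log X + (2 * Real.log 2 - 1)) with hf
  have hderiv : deriv f = fun t => t⁻¹ := by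
    funext t
    rw [hf, deriv_sub_const, Real.deriv_log]
  have hcont : ContinuousOn (fun t : ℝ => t⁻¹) (Set.Icc X (2 * X)) :=
    continuousOn_inv₀.mono fun t ht => (hX0.trans_le ht.1).ne'
  have hint : IntegrableOn (fun t : ℝ => t⁻¹) (Set.Icc X (2 * X)) :=
    hcont.integrableOn_Icc
  have habel := sum_mul_eq_sub_sub_integral_mul a (f := f) hX0.le (by linarith : X ≤ 2 * X)
    (fun t ht => (Real.differentiableAt_log (hX0.trans_le ht.1).ne').sub_const _)
    (by rw [hderiv]; exact hint)
  rw [hderiv] at habel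
  have h5 := sqrt_two_mul_le (zero_le_one.trans hX)
  have hI : |(∫ t in Set.Ioc X (2 * X), t⁻¹ * ∑ k ∈ Icc 0 ⌊t⌋₊, a k) - c * X| ≤
      K * (2 * √X) := by
    have hvol : volume.real (Set.Ioc X (2 * X)) = X := by
      rw [Real.volume_real_Ioc_of_le (by linarith)]; ring
    have hc : ∫ _ in Set.Ioc X (2 * X), c = c * X := by
      rw [setIntegral_const, hvol, smul_eq_mul, mul_comm]
    have hint2 := (integrableOn_mul_sum_Icc a (m := 0) hX0.le hint).mono_set
      Set.Ioc_subset_Icc_self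
    rw [← hc, ← integral_sub hint2 (integrable_const c)]
    have hbound : ∀ t ∈ Set.Ioc X (2 * X),
        ‖t⁻¹ * ∑ k ∈ Icc 0 ⌊t⌋₊, a k - c‖ ≤ X⁻¹ * (K * (2 * √X)) := by
      intro t ht
      have ht0 : 0 < t := hX0.trans ht.1
      rw [show t⁻¹ * ∑ k ∈ Icc 0 ⌊t⌋₊, a k - c = t⁻¹ * (∑ k ∈ Icc 0 ⌊t⌋₊, a k - c * t) by
        field_simp, norm_mul, Real.norm_of_nonneg (inv_nonneg.2 ht0.le), Real.norm_eq_abs]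
      refine mul_le_mul (inv_anti₀ hX0 ht.1.le) ?_ (abs_nonneg _) (inv_nonneg.2 hX0.le)
      refine (hA t (hX.trans ht.1.le)).trans ?_
      gcongr
      exact (Real.sqrt_le_sqrt ht.2).trans h5
    refine (norm_setIntegral_le_of_norm_le_const measure_Ioc_lt_top hbound).trans_eq ?_
    rw [hvol]
    field_simp
  have hfX : f X = 1 - 2 * Real.log 2 := by simp only [hf]; ring
  have hf2X : f (2 * X) = 1 - Real.log 2 := by simp only [hf, hlog]; ring
  have hfle (t : ℝ) (h1 : X ≤ t) (h2 : t ≤ 2 * X) : |f t| ≤ 1 := by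
    have h3 := Real.log_le_log hX0 h1
    have h4 := Real.log_le_log (hX0.trans_le h1) h2
    rw [hlog] at h4
    simp only [hf]
    rw [abs_le]
    constructor <;> linarith
  have h1 := abs_le.1 (abs_sum_Ico_ceil_sub_sum_Ioc_floor_le (g := fun n => f n * a n) (x := X)
    (y := 2 * X) (by linarith) (by linarith) hB fun n hn hn' => by
      rw [abs_mul]
      exact (mul_le_of_le_one_left (abs_nonneg _) (hfle n hn hn')).trans (ha n))
  have herr (t : ℝ) (h1 : X ≤ t) (h2 : t ≤ 2 * X) :
      |f t * ∑ k ∈ Icc 0 ⌊t⌋₊, a k - f t * (c * t)| ≤ K * √t := by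
    rw [← mul_sub, abs_mul]
    exact (mul_le_of_le_one_left (abs_nonneg _) (hfle t h1 h2)).trans (hA t (hX.trans h1))
  have h2 := abs_le.1 (herr X le_rfl (by linarith))
  have h3 := abs_le.1 (herr (2 * X) (by linarith) le_rfl)
  have h4 := abs_le.1 hI
  have h6 : 1 ≤ √X := Real.one_le_sqrt.2 hX
  have h7 := mul_le_mul_of_nonneg_left h5 hK
  have h8 := mul_le_mul_of_nonneg_left h6 hB
  have hmain : f (2 * X) * (c * (2 * X)) - f X * (c * X) - c * X = 0 := by
    rw [hfX, hf2X]; ring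
  rw [habel] at h1
  rw [abs_le]
  constructor <;> linarith

end Dyadic

/-- For fixed `D > 0`, as `X → ∞`,
`(1/(X*·log(√D·X)))·∑_{f ∈ F(X)} log(D·f²/π²)
  = 2 + log(16/(π²e²))/log(√D·X) + O(1/(X^{1/2} log X))`. -/
theorem conductor_term_asymptotic (D : ℕ) (hD : 0 < D) :
    (fun X : ℝ =>
        (1 / ((Xstar D X : ℝ) * Real.log (Real.sqrt D * X))) *
            (∑ᶠ f ∈ FSet D X, Real.log ((D : ℝ) * (f : ℝ) ^ 2 / Real.pi ^ 2))
          - (2 + Real.log (16 / (Real.pi ^ 2 * Real.exp 1 ^ 2)) /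
              Real.log (Real.sqrt D * X)))
      =O[atTop] fun X : ℝ => 1 / (X ^ ((1 : ℝ) / 2) * Real.log X) := by
  obtain ⟨c, hc, K₀, hK₀, hA⟩ := exists_abs_sum_discriminantWeight_sub_le hD
  have hcount (X : ℝ) (hX : 1 ≤ X) :=
    abs_sum_dyadic_sub_le (abs_discriminantWeight_le D) hK₀ hA hX
  have hlog (X : ℝ) (hX : 1 ≤ X) :=
    abs_sum_dyadic_log_sub_le (abs_discriminantWeight_le D) hK₀ hA hX
  set K : ℝ := 5 * K₀ + 2 * 4 with hK_def
  have hK : 0 < K := by positivity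
  refine IsBigO.of_bound (4 * K / c) ?_
  filter_upwards [eventually_ge_atTop 2, eventually_ge_atTop ((2 * K / c) ^ 2)] with X hX2 hXK
  have hX1 : 1 ≤ X := by linarith
  have hX0 : 0 < X := by linarith
  have hD1 : (1 : ℝ) ≤ D := by exact_mod_cast hD
  specialize hcount X hX1
  specialize hlog X hX1
  set S := ∑ n ∈ Finset.Ico ⌈X⌉₊ ⌈2 * X⌉₊, discriminantWeight D n with hS_def
  set W := ∑ n ∈ Finset.Ico ⌈X⌉₊ ⌈2 * X⌉₊,
    (Real.log n - (Real.log X + (2 * Real.log 2 - 1))) * discriminantWeight D n with hW_def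
  have hsqrt : √X * √X = X := Real.mul_self_sqrt hX0.le
  have hsX : 0 < √X := Real.sqrt_pos.2 hX0
  have hS : c / 2 * X ≤ S := by
    have h1 : 2 * K / c ≤ √X := Real.le_sqrt_of_sq_le hXK
    rw [div_le_iff₀ hc] at h1
    have h2 := mul_le_mul_of_nonneg_right h1 hsX.le
    have h3 := (abs_le.1 hcount).1
    linear_combination h2 / 2 + h3 + c / 2 * hsqrt
  have hS0 : 0 < S := lt_of_lt_of_le (by positivity) hS
  have hlX : 0 < Real.log X := Real.log_pos (by linarith)
  set L := Real.log (√D * X) with hL_def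
  have hLX : Real.log X ≤ L :=
    Real.log_le_log hX0 (le_mul_of_one_le_left hX0.le (Real.one_le_sqrt.2 hD1))
  have hL0 : 0 < L := hlX.trans_le hLX
  have hL : L = Real.log D / 2 + Real.log X := by
    rw [hL_def, Real.log_mul (by positivity) hX0.ne', Real.log_sqrt (by positivity)]
  have hXstar : (Xstar D X : ℝ) = S := by
    rw [Xstar, ← finsum_one, Nat.cast_finsum_mem (finite_FSet D X)]
    simp only [Nat.cast_one]
    rw [finsum_mem_FSet_eq D hX0 (h := fun _ => 1) fun _ => rfl]
    simp only [one_mul, hS_def]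
  have hconst : Real.log (16 / (Real.pi ^ 2 * Real.exp 1 ^ 2)) =
      2 * (2 * Real.log 2 - 1) - 2 * Real.log Real.pi := by
    rw [Real.log_div (by norm_num) (by positivity), Real.log_mul (by positivity) (by positivity),
      Real.log_pow, Real.log_pow, Real.log_exp, show (16 : ℝ) = 2 ^ 4 by norm_num, Real.log_pow]
    push_cast
    ring
  have hsum : ∑ᶠ f ∈ FSet D X, Real.log ((D : ℝ) * (f : ℝ) ^ 2 / Real.pi ^ 2) =
      (2 * L + Real.log (16 / (Real.pi ^ 2 * Real.exp 1 ^ 2))) * S + 2 * W := by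
    rw [finsum_mem_FSet_eq D hX0 (fun f => by push_cast; rw [neg_sq]), hS_def, hW_def,
      Finset.mul_sum, Finset.mul_sum, ← Finset.sum_add_distrib]
    refine Finset.sum_congr rfl fun n hn => ?_
    have hn0 : (0 : ℝ) < n := hX0.trans_le (Nat.ceil_le.1 (Finset.mem_Ico.1 hn).1)
    rw [Int.cast_natCast, Real.log_div (by positivity) (by positivity),
      Real.log_mul (by positivity) (by positivity), Real.log_pow, Real.log_pow, hconst, hL]
    push_cast
    ring
  rw [hsum, hXstar, show 1 / (S * L) *
      ((2 * L + Real.log (16 / (Real.pi ^ 2 * Real.exp 1 ^ 2))) * S + 2 * W) -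
      (2 + Real.log (16 / (Real.pi ^ 2 * Real.exp 1 ^ 2)) / L) = 2 * W / (S * L) by
    field_simp; ring, ← Real.sqrt_eq_rpow, Real.norm_eq_abs, Real.norm_eq_abs,
    abs_of_pos (show 0 < 1 / (√X * Real.log X) by positivity), abs_div, abs_mul, abs_two,
    abs_of_pos (mul_pos hS0 hL0)]
  calc 2 * |W| / (S * L) ≤ 2 * (K * √X) / (c / 2 * X * Real.log X) := by gcongr
    _ = 4 * K / c * (1 / (√X * Real.log X)) := by
      rw [show c / 2 * X = c / 2 * (√X * √X) by rw [hsqrt]]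
      field_simp
      norm_num
end
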